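/- Let d ≥ 1 and let G = (V, E) be a finite simple graph with |V| ≥ d + 2. If p : V → ℝ^d is a generic configuration and the framework (G, p) is isostatic, then (G, p) is not globally rigid: there exists a configuration q : V → ℝ^d equivalent to p but not congruent to p. -/

import Mathlib

noncomputable section

/-- A configuration `p : V → ℝ^d` is generic if the `d|V|` coordinates of the points
are algebraically independent over ℚ. -/
def IsGenericConfig {V : Type*} (d : ℕ) (p : V → EuclideanSpace ℝ (Fin d)) : Prop :=
  AlgebraicIndependent ℚ (fun vi : V × Fin d => p vi.1 vi.2)

/-- The rigidity matrix of the framework `(G, p)` in ℝ^d: one row per edge, `d` columns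
per vertex; the row of an edge `{u, v}` contains `p u - p v` in the columns of `u`,
`p v - p u` in the columns of `v`, and zeros elsewhere. -/
def rigidityMatrix {V : Type*} [DecidableEq V] {d : ℕ} (G : SimpleGraph V)
    (p : V → EuclideanSpace ℝ (Fin d)) : Matrix G.edgeSet (V × Fin d) ℝ :=
  fun e vi =>
    if h : vi.1 ∈ (e : Sym2 V) then (p vi.1 - p (Sym2.Mem.other h)) vi.2 else 0

/-- `(G, p)` is infinitesimally rigid in ℝ^d if `p(V)` affinely spans ℝ^d and the
rigidity matrix has rank `d|V| - d(d+1)/2`. -/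
def InfinitesimallyRigid {V : Type*} [Fintype V] [DecidableEq V] {d : ℕ}
    (G : SimpleGraph V) [DecidableRel G.Adj] (p : V → EuclideanSpace ℝ (Fin d)) : Prop :=
  affineSpan ℝ (Set.range p) = ⊤ ∧
  (rigidityMatrix G p).rank = d * Fintype.card V - d * (d + 1) / 2

/-- `(G, p)` is isostatic in ℝ^d if it is infinitesimally rigid and in addition
`|E| = d|V| - d(d+1)/2`. -/
def Isostatic {V : Type*} [Fintype V] [DecidableEq V] {d : ℕ}
    (G : SimpleGraph V) [DecidableRel G.Adj] (p : V → EuclideanSpace ℝ (Fin d)) : Prop :=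
  InfinitesimallyRigid G p ∧
  Fintype.card G.edgeSet = d * Fintype.card V - d * (d + 1) / 2

open KaehlerDifferential MvPolynomial in
theorem IsTranscendenceBasis.linearIndependent_D {k L ι : Type*} [Field k] [Field L] [CharZero k]
    [Algebra k L] {x : ι → L} (hx : IsTranscendenceBasis k x) :
    LinearIndependent L (fun i => D k L (x i)) := by
  let A' := Algebra.adjoin k (Set.range x)
  let F := IntermediateField.adjoin k (Set.range x)
  open scoped IntermediateField.algebraAdjoinAdjoin in
  have h1 : Algebra.FormallyEtale A' F := .of_isLocalization (nonZeroDivisors _)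
  have halg : Algebra.IsAlgebraic F L := hx.isAlgebraic_field
  have h2 : Algebra.FormallyEtale F L := Algebra.FormallyEtale.of_isSeparable F L
  open scoped IntermediateField.algebraAdjoinAdjoin in
  have h3 : Algebra.FormallyEtale A' L := .comp A' F L
  let _ : Algebra (MvPolynomial ι k) A' := hx.1.aevalEquiv.toRingHom.toAlgebra
  let _ : Algebra (MvPolynomial ι k) L := (aeval x : MvPolynomial ι k →ₐ[k] L).toAlgebra
  have hX : ∀ P : MvPolynomial ι k, algebraMap (MvPolynomial ι k) L P = aeval x P := fun _ => rfl
  have : IsScalarTower (MvPolynomial ι k) A' L := .of_algebraMap_eq fun P => by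
    rw [hX]; exact (hx.1.algebraMap_aevalEquiv P).symm
  have : IsScalarTower k (MvPolynomial ι k) L := .of_algebraMap_eq fun c => by
    rw [hX]; simp
  have h4 : Algebra.FormallyEtale (MvPolynomial ι k) A' :=
    .of_equiv (A := MvPolynomial ι k)
      { hx.1.aevalEquiv with commutes' := fun _ => rfl }
  have h5 : Algebra.FormallyEtale (MvPolynomial ι k) L := .comp _ A' L
  let e := tensorKaehlerEquivOfFormallyEtale k (MvPolynomial ι k) L
  let b := ((mvPolynomialBasis k ι).baseChange L).map e
  have hb : (b : ι → _) = fun i => D k L (x i) := by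
    funext i
    simp only [b, Module.Basis.map_apply, Module.Basis.baseChange_apply, mvPolynomialBasis_apply]
    rw [← LinearEquiv.eq_symm_apply]
    have := tensorKaehlerEquivOfFormallyEtale_symm_D_algebraMap k (S := MvPolynomial ι k) (T := L) (X i)
    rw [hX, aeval_X] at this
    exact this.symm
  rw [← hb]
  exact b.linearIndependent

open KaehlerDifferential in
theorem AlgebraicIndependent.linearIndependent_D {k L ι : Type*} [Field k] [Field L] [CharZero k]
    [Algebra k L] {x : ι → L} (hx : AlgebraicIndependent k x) :
    LinearIndependent L (fun i => D k L (x i)) := by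
  obtain ⟨t, hst, ht⟩ := exists_isTranscendenceBasis_superset hx.coe_range
  have h := ht.linearIndependent_D
  exact h.comp (fun i => ⟨x i, hst ⟨i, rfl⟩⟩) fun i j hij =>
    hx.injective (by simpa using hij)

open MvPolynomial in
theorem MvPolynomial.totalDegree_pderiv_lt {k ι : Type*} [CommRing k]
    (P : MvPolynomial ι k) (i : ι) (h : pderiv i P ≠ 0) :
    (pderiv i P).totalDegree < P.totalDegree := by
  obtain ⟨m, hm, hmax⟩ := Finset.exists_mem_eq_sup _ (support_nonempty.2 h)
    (fun s : ι →₀ ℕ => s.sum fun _ e => e)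
  rw [totalDegree, hmax]
  have hm' : m + Finsupp.single i 1 ∈ P.support := by
    rw [mem_support_iff, coeff_pderiv] at hm
    rw [mem_support_iff]
    intro h0
    simp [h0] at hm
  refine lt_of_lt_of_le ?_ (le_totalDegree hm')
  rw [Finsupp.sum_add_index' (by simp) (by simp)]
  simp

open MvPolynomial in
theorem MvPolynomial.eq_C_of_pderiv_eq_zero {k ι : Type*} [Field k] [CharZero k]
    (P : MvPolynomial ι k) (h : ∀ i, pderiv i P = 0) : P = C (coeff 0 P) := by
  classical
  ext m
  rw [coeff_C]
  split_ifs with h0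
  · rw [h0]
  obtain ⟨i, hi⟩ : ∃ i, m i ≠ 0 := by
    by_contra! hc
    exact h0 (Finsupp.ext fun i => by simp [hc i])
  have h1 := congrArg (coeff (m - Finsupp.single i 1)) (h i)
  have h2 : m - Finsupp.single i 1 + Finsupp.single i 1 = m :=
    tsub_add_cancel_of_le (by simpa using Nat.one_le_iff_ne_zero.2 hi)
  rw [coeff_pderiv, h2, coeff_zero] at h1
  rcases mul_eq_zero.1 h1 with h1 | h1
  · exact h1
  · exact absurd h1 (Nat.cast_add_one_ne_zero _)

open MvPolynomial in
theorem Derivation.apply_mvPolynomial_aeval {k L M ι : Type*} [CommRing k] [CommRing L] [Algebra k L]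
    [AddCommGroup M] [Module k M] [Module L M] [IsScalarTower k L M] [Fintype ι]
    (δ : Derivation k L M) (x : ι → L) (P : MvPolynomial ι k) :
    δ (aeval x P) = ∑ i, aeval x (pderiv i P) • δ (x i) := by
  classical
  induction P using MvPolynomial.induction_on with
  | C a => simp
  | add p q hp hq => simp [hp, hq, add_smul, Finset.sum_add_distrib]
  | mul_X p j hp =>
    simp only [map_mul, aeval_X, Derivation.leibniz, hp, smul_eq_mul, map_add, pderiv_X,
      add_smul, Finset.sum_add_distrib, Finset.smul_sum, smul_smul]
    congr 1
    rw [Finset.sum_eq_single j] <;> simp +contextual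

open MvPolynomial KaehlerDifferential in
theorem AlgebraicIndependent.of_linearIndependent_D {k L ι : Type*} [Field k] [Field L] [CharZero k]
    [Algebra k L] [Fintype ι] {x : ι → L} (hx : LinearIndependent L (fun i => D k L (x i))) :
    AlgebraicIndependent k x := by
  rw [algebraicIndependent_iff]
  intro P
  induction hn : P.totalDegree using Nat.strong_induction_on generalizing P with
  | _ n ih =>
    intro hP
    have h0 := (D k L).apply_mvPolynomial_aeval x P
    rw [hP, map_zero] at h0
    have h1 := Fintype.linearIndependent_iff.1 hx _ h0.symm
    have h2 : ∀ i, pderiv i P = 0 := fun i => by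
      by_contra hne
      exact hne (ih _ (hn ▸ totalDegree_pderiv_lt P i hne) _ rfl (h1 i))
    have h3 := eq_C_of_pderiv_eq_zero P h2
    rw [h3, aeval_C, map_eq_zero] at hP
    rw [h3, hP, C_0]

open Set Filter Topology NNReal Matrix

theorem exists_forall_hasDerivAt_of_lipschitzWith {E : Type*} [NormedAddCommGroup E]
    [NormedSpace ℝ E] [CompleteSpace E] {w : E → E} {K C : ℝ≥0} (hw : LipschitzWith K w)
    (hC : ∀ x, ‖w x‖ ≤ C) (x : E) :
    ∃ γ : ℝ → E, γ 0 = x ∧ ∀ t, HasDerivAt γ (w (γ t)) t := by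
  have key : ∀ n : ℕ, ∃ γ : ℝ → E, γ 0 = x ∧
      ∀ t ∈ Ioo (-(n + 1 : ℝ)) (n + 1), HasDerivAt γ (w (γ t)) t := by
    intro n
    have hn : (0 : ℝ) ≤ n + 1 := by positivity
    have h0 : (0 : ℝ) ∈ Icc (-(n + 1 : ℝ)) (n + 1) := ⟨by linarith, hn⟩
    have hpl : IsPicardLindelof (fun _ => w) ⟨0, h0⟩ x (C * (n + 1)) 0 C K :=
      { lipschitzOnWith := fun _ _ => hw.lipschitzOnWith
        continuousOn := fun _ _ => continuousOn_const
        norm_le := fun _ _ x _ => hC x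
        mul_max_le := by simp }
    obtain ⟨γ, h1, h2⟩ := hpl.exists_eq_forall_mem_Icc_hasDerivWithinAt₀
    exact ⟨γ, h1, fun t ht => (h2 t (Ioo_subset_Icc_self ht)).hasDerivAt
      (Icc_mem_nhds ht.1 ht.2)⟩
  choose γ hγ0 hγ using key
  have agree : ∀ m n : ℕ, m ≤ n → EqOn (γ m) (γ n) (Ioo (-(m + 1 : ℝ)) (m + 1)) := by
    intro m n hmn
    have hmn' : (m : ℝ) ≤ n := by exact_mod_cast hmn
    have hm : (0 : ℝ) ≤ m := by positivity
    refine ODE_solution_unique_of_mem_Ioo (v := fun _ => w) (s := fun _ => univ) (t₀ := 0)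
      (fun _ _ => hw.lipschitzOnWith) ⟨by linarith, by linarith⟩
      (fun t ht => ⟨hγ m t ht, mem_univ _⟩)
      (fun t ht => ⟨hγ n t ⟨by linarith [ht.1], by linarith [ht.2]⟩, mem_univ _⟩)
      ((hγ0 m).trans (hγ0 n).symm)
  have agree' : ∀ (m n : ℕ) (t : ℝ), |t| < m + 1 → |t| < n + 1 → γ m t = γ n t := by
    intro m n t hm hn
    rcases le_total m n with h | h
    · exact agree m n h (abs_lt.1 hm)
    · exact (agree n m h (abs_lt.1 hn)).symm
  refine ⟨fun t => γ ⌈|t|⌉₊ t, hγ0 _, fun t => ?_⟩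
  have hlt : ∀ s : ℝ, |s| < ⌈|s|⌉₊ + 1 := fun s => (Nat.le_ceil _).trans_lt (lt_add_one _)
  refine (hγ _ t (abs_lt.1 (hlt t))).congr_of_eventuallyEq ?_
  filter_upwards [Ioo_mem_nhds (abs_lt.1 (hlt t)).1 (abs_lt.1 (hlt t)).2] with s hs
  exact agree' _ _ s (hlt s) (abs_lt.2 hs)

theorem eq_of_forall_hasDerivAt {E : Type*} [NormedAddCommGroup E]
    [NormedSpace ℝ E] {w : E → E} {K : ℝ≥0} (hw : LipschitzWith K w) {γ₁ γ₂ : ℝ → E}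
    (h₁ : ∀ t, HasDerivAt γ₁ (w (γ₁ t)) t) (h₂ : ∀ t, HasDerivAt γ₂ (w (γ₂ t)) t)
    {t₀ : ℝ} (h : γ₁ t₀ = γ₂ t₀) : γ₁ = γ₂ :=
  ODE_solution_unique_univ (v := fun _ => w) (s := fun _ => univ)
    (fun _ => hw.lipschitzOnWith) (fun t => ⟨h₁ t, mem_univ _⟩) (fun t => ⟨h₂ t, mem_univ _⟩) h

theorem eq_zero_of_eq_neg_self {E : Type*} [AddCommGroup E] [Module ℝ E] {v : E} (h : v = -v) :
    v = 0 := by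
  have h2 : (2 : ℝ) • v = 0 := by rw [two_smul]; nth_rw 2 [h]; exact add_neg_cancel v
  simpa using h2

section Flow

variable {E G : Type*} [NormedAddCommGroup E] [NormedSpace ℝ E]
  [Group G] {ρ : G →* (E →L[ℝ] E)} {w : E → E} {K : ℝ≥0} {M : Set E}

/-- If a line field is preserved by `g` up to sign, then `g` maps integral curves to
integral curves, up to a time reversal. -/
theorem integralCurve_eq_map_of_eq (hw : LipschitzWith K w) (hne : ∀ x ∈ M, w x ≠ 0)
    (hGM : ∀ g, ∀ x ∈ M, ρ g x ∈ M)
    (hGw : ∀ g, ∀ x ∈ M, w (ρ g x) = ρ g (w x) ∨ w (ρ g x) = -ρ g (w x))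
    {γ₁ γ₂ : ℝ → E} (h₁ : ∀ t, HasDerivAt γ₁ (w (γ₁ t)) t)
    (h₂ : ∀ t, HasDerivAt γ₂ (w (γ₂ t)) t) (hM : ∀ t, γ₁ t ∈ M) {g : G} {a b : ℝ}
    (hab : γ₂ b = ρ g (γ₁ a)) :
    ∃ σ : ℝ, (σ = 1 ∨ σ = -1) ∧ ∀ u, γ₂ (b + u) = ρ g (γ₁ (a + σ * u)) := by
  have hc₁ : Continuous γ₁ := continuous_iff_continuousAt.2 fun t => (h₁ t).continuousAt
  have hcA : Continuous fun t => w (ρ g (γ₁ t)) :=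
    hw.continuous.comp ((ρ g).continuous.comp hc₁)
  have hcB : Continuous fun t => ρ g (w (γ₁ t)) :=
    (ρ g).continuous.comp (hw.continuous.comp hc₁)
  have sign : (∀ t, w (ρ g (γ₁ t)) = ρ g (w (γ₁ t))) ∨
      ∀ t, w (ρ g (γ₁ t)) = -ρ g (w (γ₁ t)) := by
    by_contra! hcon
    obtain ⟨⟨t₁, ht₁⟩, t₂, ht₂⟩ := hcon
    obtain ⟨t, -, e1, e2⟩ := isPreconnected_closed_iff.1 (isPreconnected_univ (α := ℝ))
      {t | w (ρ g (γ₁ t)) = ρ g (w (γ₁ t))} {t | w (ρ g (γ₁ t)) = -ρ g (w (γ₁ t))}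
      (isClosed_eq hcA hcB) (isClosed_eq hcA hcB.neg) (fun t _ => hGw g _ (hM t))
      ⟨t₂, mem_univ _, (hGw g _ (hM t₂)).resolve_right ht₂⟩
      ⟨t₁, mem_univ _, (hGw g _ (hM t₁)).resolve_left ht₁⟩
    have e3 : w (ρ g (γ₁ t)) = -w (ρ g (γ₁ t)) := by
      rw [mem_ofPred] at e1 e2
      nth_rw 2 [e1]
      exact e2
    exact hne _ (hGM g _ (hM t)) (eq_zero_of_eq_neg_self e3)
  have main : ∀ σ : ℝ, (∀ t, w (ρ g (γ₁ t)) = σ • ρ g (w (γ₁ t))) →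
      ∀ u, γ₂ (b + u) = ρ g (γ₁ (a + σ * u)) := by
    intro σ hσ u
    have d1 : ∀ t, HasDerivAt (fun u => γ₂ (b + u)) (w (γ₂ (b + t))) t := fun t =>
      (h₂ (b + t)).comp_const_add b t
    have d2 : ∀ t, HasDerivAt (fun u => ρ g (γ₁ (a + σ * u))) (w (ρ g (γ₁ (a + σ * t)))) t := by
      intro t
      have e1 : HasDerivAt (fun u : ℝ => a + σ * u) σ t := by
        simpa using ((hasDerivAt_id t).const_mul σ).const_add a
      have e2 := (ρ g).hasFDerivAt.comp_hasDerivAt t ((h₁ (a + σ * t)).scomp t e1)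
      rw [hσ, ← map_smul]
      exact e2
    exact congrFun (eq_of_forall_hasDerivAt hw d1 d2 (t₀ := 0) (by simpa using hab)) u
  rcases sign with h | h
  · exact ⟨1, .inl rfl, main 1 fun t => by rw [one_smul, h]⟩
  · exact ⟨-1, .inr rfl, main (-1) fun t => by rw [neg_one_smul, h]⟩

variable [CompleteSpace E]

theorem exists_pos_integralCurve_eq_map (hw : LipschitzWith K w) {C : ℝ≥0} (hC : ∀ x, ‖w x‖ ≤ C)
    (hMc : IsCompact M)
    (hinv : ∀ γ : ℝ → E, (∀ t, HasDerivAt γ (w (γ t)) t) → γ 0 ∈ M → ∀ t, γ t ∈ M)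
    (hne : ∀ x ∈ M, w x ≠ 0) (hGM : ∀ g, ∀ x ∈ M, ρ g x ∈ M)
    (hGw : ∀ g, ∀ x ∈ M, w (ρ g x) = ρ g (w x) ∨ w (ρ g x) = -ρ g (w x))
    (hloc : ∀ z ∈ M, ∃ (τ : E → ℝ) (τ' : E →L[ℝ] ℝ), HasStrictFDerivAt τ τ' z ∧ τ' (w z) ≠ 0 ∧
      ∃ U ∈ 𝓝 z, ∀ x ∈ U ∩ M, ∀ y ∈ U ∩ M, τ x = τ y → ∃ g, y = ρ g x)
    {γ : ℝ → E} (hγ : ∀ t, HasDerivAt γ (w (γ t)) t) (hγM : ∀ t, γ t ∈ M) :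
    ∃ T > 0, ∃ g, γ T = ρ g (γ 0) := by
  obtain ⟨z, hz, φ, hφ, hlim⟩ := hMc.tendsto_subseq (x := fun k : ℕ => γ k) fun k => hγM k
  obtain ⟨ζ, hζ0, hζ⟩ := exists_forall_hasDerivAt_of_lipschitzWith hw hC z
  have hζM := hinv ζ hζ (hζ0 ▸ hz)
  obtain ⟨τ, τ', hτ, hτ0, U, hU, hloc⟩ := hloc z hz
  have hζc : Continuous ζ := continuous_iff_continuousAt.2 fun t => (hζ t).continuousAt
  have hζs : HasStrictDerivAt ζ (w z) 0 := by
    have := hasStrictDerivAt_of_hasDerivAt_of_continuousAt (f := ζ) (f' := fun t => w (ζ t)) (x := 0)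
      (.of_forall hζ) (hw.continuous.comp hζc).continuousAt
    simpa [hζ0] using this
  have hopen : map (τ ∘ ζ) (𝓝 0) = 𝓝 (τ z) := by
    have h1 : HasStrictDerivAt (τ ∘ ζ) (τ' (w z)) 0 :=
      HasStrictFDerivAt.comp_hasStrictDerivAt 0 (by rwa [hζ0]) hζs
    simpa [hζ0] using h1.map_nhds_eq hτ0
  have hs : {s : ℝ | ζ s ∈ U ∧ |s| < 1 / 4} ∈ 𝓝 (0 : ℝ) := by
    refine inter_mem (hζc.continuousAt.preimage_mem_nhds (by rwa [hζ0])) ?_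
    have : Metric.ball (0 : ℝ) (1 / 4) ∈ 𝓝 0 := Metric.ball_mem_nhds _ (by norm_num)
    filter_upwards [this] with s hs
    show |s| < 1 / 4
    simpa using hs
  have himg := image_mem_map (m := τ ∘ ζ) hs
  rw [hopen] at himg
  have hev : ∀ᶠ k in atTop, ∃ g, ∃ s : ℝ, |s| < 1 / 4 ∧ γ (φ k) = ρ g (ζ s) := by
    filter_upwards [hlim.eventually hU, (hτ.continuousAt.tendsto.comp hlim).eventually himg]
      with k hk1 hk2
    obtain ⟨s, ⟨hs1, hs2⟩, hs3⟩ := hk2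
    obtain ⟨g, hg⟩ := hloc _ ⟨hs1, hζM s⟩ _ ⟨hk1, hγM _⟩ hs3
    exact ⟨g, s, hs2, hg⟩
  obtain ⟨N, hN⟩ := eventually_atTop.1 hev
  obtain ⟨g, s, hs, hgs⟩ := hN N le_rfl
  obtain ⟨g', s', hs', hgs'⟩ := hN (N + 1) (Nat.le_succ N)
  have hlt : (φ N : ℝ) + 1 ≤ φ (N + 1) := by exact_mod_cast hφ (Nat.lt_succ_self N)
  obtain ⟨σ, hσ, h1⟩ := integralCurve_eq_map_of_eq hw hne hGM hGw hζ hγ hζM hgs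
  obtain ⟨σ', hσ', h2⟩ := integralCurve_eq_map_of_eq hw hne hGM hGw hζ hγ hζM hgs'
  have h1 := h1 (-(φ N))
  have h2 := h2 (σ' * (s - s' - σ * φ N))
  rw [add_neg_cancel] at h1
  have hσσ : σ' * σ' = 1 := by rcases hσ' with h | h <;> rw [h] <;> norm_num
  rw [← mul_assoc, hσσ, one_mul, show s' + (s - s' - σ * φ N) = s + σ * -(φ N) by ring] at h2
  refine ⟨φ (N + 1) + σ' * (s - s' - σ * φ N), ?_, g' * g⁻¹, ?_⟩
  · rw [abs_lt] at hs hs'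
    have : (0 : ℝ) ≤ φ N := by positivity
    rcases hσ with rfl | rfl <;> rcases hσ' with rfl | rfl <;> linarith
  · rw [h2, h1, ← mul_apply_eq_comp, ← map_mul]
    simp

theorem exists_mem_ne_map_of_pos (hw : LipschitzWith K w) {C : ℝ≥0} (hC : ∀ x, ‖w x‖ ≤ C)
    (hMc : IsCompact M)
    (hinv : ∀ γ : ℝ → E, (∀ t, HasDerivAt γ (w (γ t)) t) → γ 0 ∈ M → ∀ t, γ t ∈ M)
    (hne : ∀ x ∈ M, w x ≠ 0) (hGM : ∀ g, ∀ x ∈ M, ρ g x ∈ M)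
    (hGw : ∀ g, ∀ x ∈ M, w (ρ g x) = ρ g (w x) ∨ w (ρ g x) = -ρ g (w x))
    (hfree : ∀ g, ∀ x ∈ M, ρ g x = x → g = 1)
    (hloc : ∀ z ∈ M, ∃ (τ : E → ℝ) (τ' : E →L[ℝ] ℝ), HasStrictFDerivAt τ τ' z ∧ τ' (w z) ≠ 0 ∧
      ∃ U ∈ 𝓝 z, ∀ x ∈ U ∩ M, ∀ y ∈ U ∩ M, τ x = τ y → ∃ g, y = ρ g x)
    {p : E} (hp : p ∈ M) {h : E → ℝ} {h' : E →L[ℝ] ℝ} (hh : Continuous h)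
    (hh' : HasFDerivAt h h' p) (hhG : ∀ g, ∀ x ∈ M, h (ρ g x) = h x) (hpos : 0 < h' (w p)) :
    ∃ q ∈ M, h q = h p ∧ ∀ g, q ≠ ρ g p := by
  by_contra! H
  obtain ⟨γ, hγ0, hγ⟩ := exists_forall_hasDerivAt_of_lipschitzWith hw hC p
  have hγM := hinv γ hγ (hγ0 ▸ hp)
  have hγc : Continuous γ := continuous_iff_continuousAt.2 fun t => (hγ t).continuousAt
  have hfc : Continuous fun t => h (γ t) - h p := (hh.comp hγc).sub continuous_const
  set f := fun t => h (γ t) - h p with hf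
  have hf0 : f 0 = 0 := by simp [hf, hγ0]
  have hfd : HasDerivAt f (h' (w p)) 0 := by
    have := HasFDerivAt.comp_hasDerivAt (l := h) (f := γ) 0 (by rwa [hγ0]) (hγ 0)
    rw [hγ0] at this
    exact this.sub_const _
  obtain ⟨ε, hε, hfε⟩ : ∃ ε > 0, ∀ t : ℝ, |t| < ε → 0 < t * f t ∨ t = 0 := by
    have h1 := (hasDerivAt_iff_tendsto_slope.1 hfd).eventually (lt_mem_nhds hpos)
    rw [eventually_nhdsWithin_iff, Metric.eventually_nhds_iff] at h1
    obtain ⟨ε, hε, h1⟩ := h1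
    refine ⟨ε, hε, fun t ht => ?_⟩
    by_cases ht0 : t = 0
    · exact .inr ht0
    have h2 := h1 (y := t) (by simpa using ht) ht0
    rw [slope_def_field, hf0, sub_zero, sub_zero] at h2
    left
    have h3 : t * f t = t ^ 2 * (f t / t) := by field_simp
    rw [h3]
    positivity
  have hfpos : ∀ t, 0 < t → t < ε → 0 < f t := fun t h1 h2 =>
    (pos_iff_pos_of_mul_pos ((hfε t (by rwa [abs_of_pos h1])).resolve_right h1.ne')).1 h1
  have hfneg : ∀ t, t < 0 → -ε < t → f t < 0 := fun t h1 h2 =>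
    (neg_iff_neg_of_mul_pos ((hfε t (by rw [abs_of_neg h1]; linarith)).resolve_right h1.ne)).1 h1
  have hfK : ∀ s t g, γ s = ρ g (γ t) → f s = f t := fun s t g hst => by
    simp only [hf, hst, hhG g _ (hγM t)]
  obtain ⟨T₀, hT₀, g₀, hg₀⟩ := exists_pos_integralCurve_eq_map hw hC hMc hinv hne hGM hGw hloc hγ hγM
  have hfT₀ : f T₀ = 0 := (hfK _ _ _ hg₀).trans hf0
  have hεT₀ : ε ≤ T₀ := by
    by_contra! hlt
    exact (hfpos _ hT₀ hlt).ne' hfT₀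
  have hcomp : IsCompact (Icc ε T₀ ∩ f ⁻¹' {0}) :=
    isCompact_Icc.inter_right (isClosed_singleton.preimage hfc)
  obtain ⟨T, ⟨⟨hT1, hT2⟩, hT3⟩, hTmin⟩ := hcomp.exists_isLeast ⟨T₀, ⟨hεT₀, le_rfl⟩, hfT₀⟩
  have hTpos : 0 < T := hε.trans_le hT1
  have hfne : ∀ t, 0 < t → t < T → f t ≠ 0 := by
    intro t h1 h2 h3
    rcases lt_or_ge t ε with h4 | h4
    · exact (hfpos t h1 h4).ne' h3
    · exact h2.not_ge (hTmin ⟨⟨h4, h2.le.trans hT2⟩, h3⟩)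
  have hfT : ∀ t, 0 < t → t < T → 0 < f t := by
    intro t h1 h2
    by_contra! h3
    have h4 : min t ε / 2 ≤ t := by
      have := min_le_left t ε
      linarith
    have h5 : 0 < min t ε := lt_min h1 hε
    obtain ⟨s, hs, hs0⟩ := intermediate_value_Icc' h4 hfc.continuousOn
      ⟨h3, (hfpos _ (half_pos h5) (by have := min_le_right t ε; linarith)).le⟩
    exact hfne s ((half_pos h5).trans_le hs.1) (hs.2.trans_lt h2) hs0
  obtain ⟨g, hg⟩ := H (γ T) (hγM T) (sub_eq_zero.1 hT3)
  rw [← hγ0] at hg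
  obtain ⟨σ, hσ, hK⟩ := integralCurve_eq_map_of_eq hw hne hGM hGw hγ hγ hγM hg
  rcases hσ with rfl | rfl
  · have h1 := hfK _ _ _ (hK (-(ε / 2)))
    have h2 := hfT (T + -(ε / 2)) (by linarith) (by linarith)
    have h3 := hfneg (0 + 1 * -(ε / 2)) (by linarith) (by linarith)
    linarith
  · have h1 := hK (-(T / 2))
    rw [show T + -(T / 2) = T / 2 by ring, show 0 + -1 * -(T / 2) = T / 2 by ring] at h1
    have hg1 := hfree g _ (hγM _) h1.symm
    subst hg1
    have d1 : HasDerivAt (fun u => γ (T + u)) (w (γ (T / 2))) (-(T / 2)) := by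
      have := (hγ (T + -(T / 2))).comp_const_add T (-(T / 2))
      rwa [show T + -(T / 2) = T / 2 by ring] at this
    have d2 : HasDerivAt (fun u => γ (T + u)) (-w (γ (T / 2))) (-(T / 2)) := by
      have e0 : (fun u => γ (T + u)) = fun u => γ (-u) := by
        funext u
        rw [hK u]
        simp
      have e1 := (hγ (-(-(T / 2)))).scomp (-(T / 2)) (hasDerivAt_neg (-(T / 2)))
      rw [e0]
      rw [neg_neg, neg_one_smul] at e1
      exact e1
    exact hne _ (hγM _) (eq_zero_of_eq_neg_self (d1.unique d2))

/-- An integral curve inside a compact set `M`, on which a group acts freely so that the flow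
covers nearby orbits, must meet a level set of an invariant function in a second orbit. -/
theorem exists_mem_ne_map (hw : LipschitzWith K w) {C : ℝ≥0} (hC : ∀ x, ‖w x‖ ≤ C)
    (hMc : IsCompact M)
    (hinv : ∀ γ : ℝ → E, (∀ t, HasDerivAt γ (w (γ t)) t) → γ 0 ∈ M → ∀ t, γ t ∈ M)
    (hne : ∀ x ∈ M, w x ≠ 0) (hGM : ∀ g, ∀ x ∈ M, ρ g x ∈ M)
    (hGw : ∀ g, ∀ x ∈ M, w (ρ g x) = ρ g (w x) ∨ w (ρ g x) = -ρ g (w x))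
    (hfree : ∀ g, ∀ x ∈ M, ρ g x = x → g = 1)
    (hloc : ∀ z ∈ M, ∃ (τ : E → ℝ) (τ' : E →L[ℝ] ℝ), HasStrictFDerivAt τ τ' z ∧ τ' (w z) ≠ 0 ∧
      ∃ U ∈ 𝓝 z, ∀ x ∈ U ∩ M, ∀ y ∈ U ∩ M, τ x = τ y → ∃ g, y = ρ g x)
    {p : E} (hp : p ∈ M) {h : E → ℝ} {h' : E →L[ℝ] ℝ} (hh : Continuous h)
    (hh' : HasFDerivAt h h' p) (hhG : ∀ g, ∀ x ∈ M, h (ρ g x) = h x) (hh0 : h' (w p) ≠ 0) :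
    ∃ q ∈ M, h q = h p ∧ ∀ g, q ≠ ρ g p := by
  rcases lt_or_gt_of_ne hh0 with hlt | hlt
  · obtain ⟨q, hq, hq1, hq2⟩ := exists_mem_ne_map_of_pos hw hC hMc hinv hne hGM hGw hfree hloc hp
      hh.neg hh'.neg (fun g x hx => by simp [hhG g x hx]) (by simpa using hlt)
    exact ⟨q, hq, neg_injective hq1, hq2⟩
  · exact exists_mem_ne_map_of_pos hw hC hMc hinv hne hGM hGw hfree hloc hp hh hh' hhG hlt

end Flow

theorem ContDiff.matrix_det {E κ : Type*} [NormedAddCommGroup E] [NormedSpace ℝ E] [Fintype κ]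
    [DecidableEq κ] {n : WithTop ℕ∞} {A : E → Matrix κ κ ℝ}
    (hA : ∀ i j, ContDiff ℝ n fun x => A x i j) : ContDiff ℝ n fun x => (A x).det := by
  simp only [Matrix.det_apply]
  exact ContDiff.sum fun σ _ => (contDiff_prod fun i _ => hA _ _).const_smul _

/-- Generalised cross product of a smooth family of vectors. -/
theorem exists_contDiff_cross {E κ ι : Type*} [NormedAddCommGroup E] [NormedSpace ℝ E]
    [Fintype κ] [Fintype ι] {n : WithTop ℕ∞} {c : ι → E → κ → ℝ}
    (hc : ∀ i, ContDiff ℝ n (c i)) (hcard : Fintype.card ι + 1 = Fintype.card κ) :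
    ∃ v : E → κ → ℝ, ContDiff ℝ n v ∧ (∀ i x, c i x ⬝ᵥ v x = 0) ∧
      ∀ x, LinearIndependent ℝ (fun i => c i x) → v x ≠ 0 := by
  classical
  have e : Option ι ≃ κ := Fintype.equivOfCardEq (by simpa using hcard)
  let A : E → Matrix κ κ ℝ := fun x k => (e.symm k).elim 0 fun i => c i x
  let v : E → κ → ℝ := fun x k => ((A x).updateRow (e none) (Pi.single k 1)).det
  have hv : ∀ x y, y ⬝ᵥ v x = ((A x).updateRow (e none) y).det := by
    intro x y
    rw [← cramer_transpose_apply]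
    conv_rhs => rw [pi_eq_sum_univ' y, map_sum]
    rw [Finset.sum_apply]
    refine Finset.sum_congr rfl fun k _ => ?_
    rw [map_smul, Pi.smul_apply, cramer_transpose_apply]
    rfl
  have hAsome : ∀ x i, A x (e (some i)) = c i x := fun x i => by simp [A]
  refine ⟨v, ?_, ?_, ?_⟩
  · rw [contDiff_pi]
    intro k
    refine ContDiff.matrix_det fun i j => ?_
    obtain ⟨o, rfl⟩ := e.surjective i
    rcases o with _ | i
    · simp only [updateRow_self]
      exact contDiff_const
    · have h : e (some i) ≠ e none := by simp
      simp only [updateRow_ne h, hAsome]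
      exact contDiff_pi.1 (hc i) j
  · intro i x
    rw [hv]
    have h : e (some i) ≠ e none := by simp
    refine det_zero_of_row_eq h ?_
    rw [updateRow_ne h, updateRow_self, hAsome]
  · intro x hx h0
    have hspan : Submodule.span ℝ (range fun i => c i x) ≠ ⊤ := by
      intro htop
      have h1 := finrank_span_eq_card hx
      rw [htop, finrank_top, Module.finrank_fintype_fun_eq_card] at h1
      omega
    obtain ⟨y, -, hy⟩ := SetLike.exists_of_lt (lt_top_iff_ne_top.2 hspan)
    have h2 : LinearIndependent ℝ fun o : Option ι => (o.casesOn' y fun i => c i x : κ → ℝ) :=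
      linearIndependent_option'.2 ⟨hx, hy⟩
    have h3 : LinearIndependent ℝ ((A x).updateRow (e none) y).row := by
      rw [← linearIndependent_equiv e]
      convert h2 using 1
      funext o
      rcases o with _ | i
      · ext; simp
      · ext
        simp [hAsome]
    have h4 := (isUnit_iff_isUnit_det _).1 (linearIndependent_rows_iff_isUnit.1 h3)
    rw [← hv, h0, dotProduct_zero] at h4
    exact not_isUnit_zero h4

theorem exists_lipschitzWith_unit_orthogonal {κ ι : Type*} [Fintype κ] [Fintype ι]
    {c : ι → (κ → ℝ) → κ → ℝ} (hc : ∀ i, ContDiff ℝ 1 (c i))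
    (hcard : Fintype.card ι + 1 = Fintype.card κ) {M : Set (κ → ℝ)} (hM : IsCompact M)
    (hind : ∀ x ∈ M, LinearIndependent ℝ fun i => c i x) :
    ∃ (w : (κ → ℝ) → κ → ℝ) (K C : ℝ≥0), LipschitzWith K w ∧ (∀ x, ‖w x‖ ≤ C) ∧
      (∀ i x, c i x ⬝ᵥ w x = 0) ∧ ∀ x ∈ M, w x ⬝ᵥ w x = 1 := by
  obtain ⟨v, hv, hcv, hv0⟩ := exists_contDiff_cross hc hcard
  have hs : ContDiff ℝ 1 fun x => v x ⬝ᵥ v x :=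
    ContDiff.sum fun k _ => (contDiff_pi.1 hv k).mul (contDiff_pi.1 hv k)
  have hs0 : ∀ x, 0 ≤ v x ⬝ᵥ v x := fun x => Finset.sum_nonneg fun k _ => mul_self_nonneg _
  obtain ⟨m, hm, hmM⟩ : ∃ m > 0, ∀ x ∈ M, m ≤ v x ⬝ᵥ v x := by
    refine hM.exists_forall_le' hs.continuous.continuousOn fun x hx => ?_
    exact (hs0 x).lt_of_ne' (dotProduct_self_eq_zero.not.2 (hv0 x (hind x hx)))
  obtain ⟨R, hR⟩ := hM.isBounded.subset_ball 0
  let χ : ContDiffBump (0 : κ → ℝ) := ⟨max R 1, max R 1 + 1, by positivity, by linarith⟩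
  let g : (κ → ℝ) → ℝ := fun x =>
    v x ⬝ᵥ v x + Real.smoothTransition (1 - v x ⬝ᵥ v x / m)
  have hg : ContDiff ℝ 1 g :=
    hs.add (Real.smoothTransition.contDiff.comp (contDiff_const.sub (hs.div_const m)))
  have hgpos : ∀ x, 0 < g x := by
    intro x
    rcases lt_or_ge (v x ⬝ᵥ v x) m with h | h
    · have : 0 < Real.smoothTransition (1 - v x ⬝ᵥ v x / m) :=
        Real.smoothTransition.pos_of_pos (by rw [sub_pos, div_lt_one hm]; exact h)
      have := hs0 x
      positivity
    · have := Real.smoothTransition.nonneg (1 - v x ⬝ᵥ v x / m)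
      have := hm.trans_le h
      positivity
  have hgM : ∀ x ∈ M, g x = v x ⬝ᵥ v x := by
    intro x hx
    have : Real.smoothTransition (1 - v x ⬝ᵥ v x / m) = 0 :=
      Real.smoothTransition.zero_of_nonpos (by
        rw [sub_nonpos, one_le_div hm]; exact hmM x hx)
    simp only [g, this, add_zero]
  let w : (κ → ℝ) → κ → ℝ := fun x => (χ x / √(g x)) • v x
  have hw : ContDiff ℝ 1 w :=
    (χ.contDiff.div (hg.sqrt fun x => (hgpos x).ne') fun x =>
      (Real.sqrt_pos.2 (hgpos x)).ne').smul hv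
  have hcs : HasCompactSupport w := by
    refine χ.hasCompactSupport.mono' ?_
    refine subset_trans ?_ subset_closure
    intro x hx h0
    exact hx (by simp [w, h0])
  obtain ⟨K, hK⟩ := hw.lipschitzWith_of_hasCompactSupport hcs one_ne_zero
  obtain ⟨C, hC⟩ := hcs.exists_bound_of_continuous hw.continuous
  refine ⟨w, K, C.toNNReal, hK, fun x => (hC x).trans (Real.le_coe_toNNReal C), fun i x => ?_,
    fun x hx => ?_⟩
  · simp [w, hcv]
  · have h1 : χ x = 1 := χ.one_of_mem_closedBall
      (Metric.closedBall_subset_closedBall (le_max_left R 1) (Metric.ball_subset_closedBall (hR hx)))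
    simp only [w, h1, smul_dotProduct, dotProduct_smul, smul_eq_mul, hgM x hx]
    have h2 := hm.trans_le (hmM x hx)
    have h3 := Real.mul_self_sqrt h2.le
    have h4 := Real.sqrt_pos.2 h2
    field_simp
    linarith [sq (√(v x ⬝ᵥ v x))]

section DotProduct

variable {κ ι ι' : Type*} [Fintype κ]

theorem dotProduct_eq_zero_of_mem_span {t : ι → κ → ℝ} {y z : κ → ℝ} (h : ∀ i, y ⬝ᵥ t i = 0)
    (hz : z ∈ Submodule.span ℝ (range t)) : y ⬝ᵥ z = 0 := by
  induction hz using Submodule.span_induction with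
  | mem z hz => obtain ⟨i, rfl⟩ := hz; exact h i
  | zero => simp
  | add a b _ _ ha hb => rw [dotProduct_add, ha, hb, add_zero]
  | smul c a _ ha => rw [dotProduct_smul, ha, smul_zero]

theorem LinearIndependent.sumElim_of_dotProduct_eq_zero {r : ι → κ → ℝ} {t : ι' → κ → ℝ}
    (hr : LinearIndependent ℝ r) (ht : LinearIndependent ℝ t) (h : ∀ i j, r i ⬝ᵥ t j = 0) :
    LinearIndependent ℝ (Sum.elim r t) := by
  refine hr.sum_type ht (Submodule.disjoint_def.2 fun y h1 h2 => ?_)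
  refine dotProduct_self_eq_zero.1 (dotProduct_eq_zero_of_mem_span (fun j => ?_) h2)
  rw [dotProduct_comm]
  exact dotProduct_eq_zero_of_mem_span (fun i => by rw [dotProduct_comm, h]) h1

theorem LinearIndependent.eq_zero_of_dotProduct_eq_zero [Fintype ι] {c : ι → κ → ℝ}
    (hc : LinearIndependent ℝ c) (hcard : Fintype.card ι = Fintype.card κ) {y : κ → ℝ}
    (hy : ∀ i, c i ⬝ᵥ y = 0) : y = 0 := by
  have htop : Submodule.span ℝ (range c) = ⊤ :=
    hc.span_eq_top_of_card_eq_finrank' (by rw [hcard, Module.finrank_fintype_fun_eq_card])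
  exact dotProduct_self_eq_zero.1 (dotProduct_eq_zero_of_mem_span
    (fun i => by rw [dotProduct_comm, hy]) (htop ▸ Submodule.mem_top))

/-- If `r` and `t` are orthogonal and together form a basis, then the orthogonal complements of
their spans are orthogonal. -/
theorem LinearIndependent.dotProduct_eq_zero_of_sumElim [Fintype ι] [Fintype ι']
    {r : ι → κ → ℝ} {t : ι' → κ → ℝ} (h : LinearIndependent ℝ (Sum.elim r t))
    (hcard : Fintype.card ι + Fintype.card ι' = Fintype.card κ)
    (hrt : ∀ i j, r i ⬝ᵥ t j = 0) {y z : κ → ℝ} (hy : ∀ j, y ⬝ᵥ t j = 0)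
    (hz : ∀ i, r i ⬝ᵥ z = 0) : y ⬝ᵥ z = 0 := by
  have htop : Submodule.span ℝ (range (Sum.elim r t)) = ⊤ :=
    h.span_eq_top_of_card_eq_finrank' (by
      rw [Module.finrank_fintype_fun_eq_card, ← hcard, Fintype.card_sum])
  have hmem : y ∈ Submodule.span ℝ (range (Sum.elim r t)) := htop ▸ Submodule.mem_top
  rw [Set.Sum.elim_range, Submodule.span_union, Submodule.mem_sup] at hmem
  obtain ⟨a, ha, b, hb, rfl⟩ := hmem
  have h1 : a ⬝ᵥ b = 0 := by
    refine dotProduct_eq_zero_of_mem_span (fun j => ?_) hb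
    rw [dotProduct_comm]
    exact dotProduct_eq_zero_of_mem_span (fun i => by rw [dotProduct_comm, hrt]) ha
  have h2 : (a + b) ⬝ᵥ b = 0 := dotProduct_eq_zero_of_mem_span hy hb
  rw [add_dotProduct, h1, zero_add, dotProduct_self_eq_zero] at h2
  rw [h2, add_zero, dotProduct_comm]
  exact dotProduct_eq_zero_of_mem_span (fun i => by rw [dotProduct_comm, hz]) ha

theorem LinearIndependent.eq_or_eq_neg_of_dotProduct_eq_zero [Fintype ι] {c : ι → κ → ℝ}
    (hc : LinearIndependent ℝ c) (hcard : Fintype.card ι + 1 = Fintype.card κ) {y z : κ → ℝ}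
    (hy : ∀ i, c i ⬝ᵥ y = 0) (hz : ∀ i, c i ⬝ᵥ z = 0) (hy1 : y ⬝ᵥ y = 1) (hz1 : z ⬝ᵥ z = 1) :
    y = z ∨ y = -z := by
  have hz' : z ∉ Submodule.span ℝ (range c) := fun h => by
    have := dotProduct_eq_zero_of_mem_span (fun i => by rw [dotProduct_comm, hz]) h
    rw [hz1] at this
    exact one_ne_zero this
  have h2 : LinearIndependent ℝ fun o : Option ι => (o.casesOn' z c : κ → ℝ) :=
    linearIndependent_option'.2 ⟨hc, hz'⟩
  have h3 : y - (y ⬝ᵥ z) • z = 0 := by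
    refine h2.eq_zero_of_dotProduct_eq_zero (by simpa using hcard) fun o => ?_
    rcases o with _ | i
    · simp [hz1, dotProduct_comm z y]
    · simp [hy, hz]
  have h4 : y = (y ⬝ᵥ z) • z := sub_eq_zero.1 h3
  have h5 : (y ⬝ᵥ z) * (y ⬝ᵥ z) = 1 := by
    have := hy1
    rw [h4, smul_dotProduct, dotProduct_smul, hz1] at this
    simpa using this
  rcases mul_self_eq_one_iff.1 h5 with h | h
  · left; rw [h, one_smul] at h4; exact h4
  · right; rw [h, neg_one_smul] at h4; exact h4

end DotProduct

section Configuration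

variable {V : Type*} [Fintype V] {k : ℕ}

/-- Squared distance between two vertices of a configuration in coordinates. -/
def sqDist (u w : V) (x : V × Fin k → ℝ) : ℝ := ∑ i, (x (u, i) - x (w, i)) ^ 2

/-- Half the gradient of `sqDist u w`. -/
def pairRow [DecidableEq V] (u w : V) (x : V × Fin k → ℝ) : V × Fin k → ℝ := fun a =>
  ((Pi.single u 1 : V → ℝ) a.1 - (Pi.single w 1 : V → ℝ) a.1) * (x (u, a.2) - x (w, a.2))

/-- The infinitesimal translations and rotations of a configuration. -/
def trivialMotion : Fin k ⊕ {ij : Fin k × Fin k // ij.1 < ij.2} → (V × Fin k → ℝ) → V × Fin k → ℝ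
  | .inl i, _ => fun a => (Pi.single i 1 : Fin k → ℝ) a.2
  | .inr ij, x => fun a =>
      (Pi.single ij.1.1 1 : Fin k → ℝ) a.2 * x (a.1, ij.1.2) -
        (Pi.single ij.1.2 1 : Fin k → ℝ) a.2 * x (a.1, ij.1.1)

/-- The configuration as a matrix whose rows are the points. -/
def configMatrix (x : V × Fin k → ℝ) : Matrix V (Fin k) ℝ := .of fun v i => x (v, i)

theorem pairRow_dotProduct [DecidableEq V] (u w : V) (x y : V × Fin k → ℝ) :
    pairRow u w x ⬝ᵥ y = ∑ i, (x (u, i) - x (w, i)) * (y (u, i) - y (w, i)) := by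
  simp only [dotProduct, pairRow, Fintype.sum_prod_type_right]
  refine Finset.sum_congr rfl fun i _ => ?_
  simp only [sub_mul, Finset.sum_sub_distrib, Pi.single_apply, ite_mul, one_mul,
    zero_mul, Finset.sum_ite_eq', Finset.mem_univ, if_true]
  ring

theorem pairRow_dotProduct_trivialMotion [DecidableEq V] (u w : V) (x : V × Fin k → ℝ) (s) :
    pairRow u w x ⬝ᵥ trivialMotion s x = 0 := by
  rw [pairRow_dotProduct]
  rcases s with i | ⟨⟨i, j⟩, hij⟩
  · simp [trivialMotion]
  · simp only [trivialMotion, Pi.single_apply, ite_mul, one_mul, zero_mul, mul_sub,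
      Finset.sum_sub_distrib, mul_ite, mul_zero, Finset.sum_ite_eq',
      Finset.mem_univ, if_true]
    ring

theorem trivialMotion_inl_dotProduct (i : Fin k) (x y : V × Fin k → ℝ) :
    trivialMotion (.inl i) x ⬝ᵥ y = ∑ v, y (v, i) := by
  simp only [dotProduct, trivialMotion, Fintype.sum_prod_type, Pi.single_apply, ite_mul, one_mul,
    zero_mul, Finset.sum_ite_eq', Finset.mem_univ, if_true]

theorem trivialMotion_inr_dotProduct (ij : {ij : Fin k × Fin k // ij.1 < ij.2})
    (x y : V × Fin k → ℝ) :
    trivialMotion (.inr ij) x ⬝ᵥ y =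
      ((configMatrix y)ᵀ * configMatrix x) ij.1.1 ij.1.2 -
        ((configMatrix y)ᵀ * configMatrix x) ij.1.2 ij.1.1 := by
  simp only [dotProduct, trivialMotion, Fintype.sum_prod_type, Pi.single_apply, ite_mul, one_mul,
    zero_mul, sub_mul, Finset.sum_sub_distrib, Finset.sum_ite_eq',
    Finset.mem_univ, if_true, Matrix.mul_apply, Matrix.transpose_apply, configMatrix, Matrix.of_apply]
  congr 1 <;> exact Finset.sum_congr rfl fun v _ => mul_comm _ _

theorem forall_trivialMotion_dotProduct_eq_zero_iff (x y : V × Fin k → ℝ) :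
    (∀ s, trivialMotion s x ⬝ᵥ y = 0) ↔
      (∀ i, ∑ v, y (v, i) = 0) ∧ ((configMatrix y)ᵀ * configMatrix x).IsSymm := by
  constructor
  · intro h
    refine ⟨fun i => by rw [← trivialMotion_inl_dotProduct i x, h], Matrix.IsSymm.ext fun i j => ?_⟩
    rcases lt_trichotomy i j with hij | rfl | hij
    · have := h (.inr ⟨(i, j), hij⟩)
      rw [trivialMotion_inr_dotProduct] at this
      exact (sub_eq_zero.1 this).symm
    · rfl
    · have := h (.inr ⟨(j, i), hij⟩)
      rw [trivialMotion_inr_dotProduct] at this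
      exact (sub_eq_zero.1 this)
  · rintro ⟨h1, h2⟩ (i | ij)
    · rw [trivialMotion_inl_dotProduct, h1]
    · rw [trivialMotion_inr_dotProduct, h2.apply, sub_self]

theorem two_mul_card_trivialMotion :
    2 * Fintype.card (Fin k ⊕ {ij : Fin k × Fin k // ij.1 < ij.2}) = k * (k + 1) := by
  have h : Fintype.card {ij : Fin k × Fin k // ij.1 < ij.2} = k.choose 2 := by
    rw [Fintype.card_subtype, Finset.card_filter, Fintype.sum_prod_type_right]
    simp only [← Finset.card_filter, Finset.filter_gt_eq_Iio, Fin.card_Iio]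
    rw [Fin.sum_univ_eq_sum_range (fun i => i), Finset.sum_range_id, Nat.choose_two_right]
  rw [Fintype.card_sum, Fintype.card_fin, h, Nat.choose_two_right, mul_add,
    Nat.mul_div_cancel' (Nat.even_mul_pred_self k).two_dvd]
  rcases k with _ | k
  · rfl
  · simp; ring

theorem linearIndependent_trivialMotion [Nonempty V] {x : V × Fin k → ℝ}
    (hx0 : ∀ i, ∑ v, x (v, i) = 0) (hx : ∀ a, configMatrix x *ᵥ a = 0 → a = 0) :
    LinearIndependent ℝ fun s => trivialMotion (V := V) (k := k) s x := by
  rw [Fintype.linearIndependent_iff]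
  intro b hb
  let B : Matrix (Fin k) (Fin k) ℝ := fun i j => if h : i < j then b (.inr ⟨(i, j), h⟩) else 0
  have key : ∀ v l, b (.inl l) + (configMatrix x *ᵥ (B l - Bᵀ l)) v = 0 := by
    intro v l
    have h1 := congrFun hb (v, l)
    simp only [Fintype.sum_sum_type, Finset.sum_apply, Pi.smul_apply, smul_eq_mul,
      Pi.zero_apply] at h1
    have h2 : ∀ f : Fin k → Fin k → ℝ,
        ∑ s : {ij : Fin k × Fin k // ij.1 < ij.2}, b (.inr s) * f s.1.1 s.1.2 =
          ∑ i, ∑ j, B i j * f i j := by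
      intro f
      have h3 : ∀ s : {ij : Fin k × Fin k // ij.1 < ij.2},
          b (.inr s) * f s.1.1 s.1.2 = B s.1.1 s.1.2 * f s.1.1 s.1.2 := by
        rintro ⟨⟨i, j⟩, hij⟩
        have hij' : i < j := hij
        simp [B, hij']
      rw [Finset.sum_congr rfl fun s _ => h3 s, ← Finset.sum_subtype
        (Finset.univ.filter fun ij : Fin k × Fin k => ij.1 < ij.2) (by simp)
        fun ij => B ij.1 ij.2 * f ij.1 ij.2, Finset.sum_filter_of_ne, Fintype.sum_prod_type]
      intro ij _ h0
      by_contra hlt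
      exact h0 (by simp [B, hlt])
    have h4 := h2 fun i j => (Pi.single i 1 : Fin k → ℝ) l * x (v, j) -
      (Pi.single j 1 : Fin k → ℝ) l * x (v, i)
    simp only [trivialMotion] at h1
    rw [h4] at h1
    rw [← h1]
    congr 1
    · simp [Pi.single_apply]
    · simp only [mul_sub, Finset.sum_sub_distrib, mulVec, dotProduct, configMatrix, Pi.sub_apply,
        Matrix.transpose_apply, of_apply]
      simp [Pi.single_apply, mul_comm]
  have hl : ∀ l, b (.inl l) = 0 := by
    intro l
    have h1 : ∑ v, (b (.inl l) + (configMatrix x *ᵥ (B l - Bᵀ l)) v) = 0 :=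
      Finset.sum_eq_zero fun v _ => key v l
    have h2 : ∑ v, (configMatrix x *ᵥ (B l - Bᵀ l)) v = 0 := by
      simp only [mulVec, dotProduct]
      rw [Finset.sum_comm]
      refine Finset.sum_eq_zero fun i _ => ?_
      rw [← Finset.sum_mul]
      simp [configMatrix, hx0]
    rw [Finset.sum_add_distrib, h2, add_zero, Finset.sum_const, smul_eq_zero] at h1
    exact h1.resolve_left (by simp)
  have hB : ∀ l, B l - Bᵀ l = 0 := fun l => hx _ (by
    ext v
    have := key v l
    rwa [hl, zero_add] at this)
  rintro (l | ⟨⟨i, j⟩, hij⟩)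
  · exact hl l
  · have := congrFun (hB i) j
    have hji : ¬ j < i := not_lt.2 (le_of_lt hij)
    have hij' : i < j := hij
    rw [Pi.sub_apply, Matrix.transpose_apply] at this
    simpa [B, hij', hji] using this

end Configuration

section Congruence

variable {V : Type*} {k : ℕ}

theorem Matrix.eq_zero_of_sum_eq_zero_of_diag_add [Fintype V] {H : Matrix V V ℝ}
    (hsum : ∀ u, ∑ w, H u w = 0) (h : ∀ u w, H u u + H w w = 2 * H u w) : H = 0 := by
  have h1 : ∀ u, Fintype.card V * H u u + H.trace = 0 := by
    intro u
    have := Finset.sum_congr rfl fun w (_ : w ∈ Finset.univ) => h u w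
    rw [Finset.sum_add_distrib, ← Finset.mul_sum, hsum] at this
    simpa [Matrix.trace] using this
  have h2 : H.trace = 0 := by
    rcases isEmpty_or_nonempty V with hV | hV
    · simp [Matrix.trace]
    have := Finset.sum_congr rfl fun u (_ : u ∈ Finset.univ) => h1 u
    rw [Finset.sum_add_distrib, ← Finset.mul_sum] at this
    have h3 : (Fintype.card V : ℝ) * H.trace + Fintype.card V * H.trace = 0 := by
      simpa [Matrix.trace] using this
    have h4 : (0 : ℝ) < Fintype.card V := by exact_mod_cast Fintype.card_pos
    nlinarith
  have h5 : ∀ u, H u u = 0 := by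
    intro u
    have : Nonempty V := ⟨u⟩
    have h4 : (Fintype.card V : ℝ) ≠ 0 := by exact_mod_cast Fintype.card_ne_zero
    have := h1 u
    rw [h2, add_zero] at this
    exact (mul_eq_zero.1 this).resolve_left h4
  ext u w
  have := h u w
  rw [h5, h5] at this
  simpa using this.symm

theorem configMatrix_mul_transpose_apply (x y : V × Fin k → ℝ) (u w : V) :
    (configMatrix x * (configMatrix y)ᵀ) u w = ∑ i, x (u, i) * y (w, i) := rfl

theorem sum_configMatrix_mul_transpose [Fintype V] {x y : V × Fin k → ℝ} (hy : ∀ i, ∑ v, y (v, i) = 0)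
    (u : V) : ∑ w, (configMatrix x * (configMatrix y)ᵀ) u w = 0 := by
  simp only [configMatrix_mul_transpose_apply]
  rw [Finset.sum_comm]
  simp [← Finset.mul_sum, hy]

theorem Matrix.eq_zero_of_transpose_mul_self {m n : Type*} [Fintype m] [Fintype n]
    {A : Matrix m n ℝ} (h : Aᵀ * A = 0) : A = 0 := by
  rwa [← Matrix.conjTranspose_eq_transpose_of_trivial,
    Matrix.conjTranspose_mul_self_eq_zero] at h

theorem mul_eq_zero_of_configMatrix {m : Type*} [Fintype m] {x : V × Fin k → ℝ}
    (hx : ∀ a, configMatrix x *ᵥ a = 0 → a = 0) {B : Matrix (Fin k) m ℝ}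
    (hB : configMatrix x * B = 0) : B = 0 := by
  ext i j
  refine congrFun (hx (fun i => B i j) ?_) i
  ext v
  exact congrFun (congrFun hB v) j

/-- A spanning configuration has no nonzero motion that is orthogonal to the trivial ones and
preserves all distances to first order. -/
theorem eq_zero_of_forall_pairRow_dotProduct [Fintype V] [DecidableEq V] {x y : V × Fin k → ℝ}
    (hx0 : ∀ i, ∑ v, x (v, i) = 0) (hx : ∀ a, configMatrix x *ᵥ a = 0 → a = 0)
    (ht : ∀ s, trivialMotion s x ⬝ᵥ y = 0) (hy : ∀ u w, pairRow u w x ⬝ᵥ y = 0) : y = 0 := by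
  obtain ⟨hy0, hsymm⟩ := (forall_trivialMotion_dotProduct_eq_zero_iff x y).1 ht
  set X := configMatrix x with hX
  set Y := configMatrix y with hY
  have h1 : X * Yᵀ + Y * Xᵀ = 0 := by
    refine Matrix.eq_zero_of_sum_eq_zero_of_diag_add (fun u => ?_) (fun u w => ?_)
    · simp only [Matrix.add_apply, Finset.sum_add_distrib]
      rw [hX, hY, sum_configMatrix_mul_transpose hy0, sum_configMatrix_mul_transpose hx0, add_zero]
    · have h2 := hy u w
      rw [pairRow_dotProduct] at h2
      have h3 : ∑ i, (x (u, i) - x (w, i)) * (y (u, i) - y (w, i)) =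
          ∑ i, x (u, i) * y (u, i) + ∑ i, x (w, i) * y (w, i) -
            (∑ i, x (u, i) * y (w, i) + ∑ i, y (u, i) * x (w, i)) := by
        simp only [← Finset.sum_add_distrib, ← Finset.sum_sub_distrib]
        exact Finset.sum_congr rfl fun i _ => by ring
      have h4 : ∀ v, ∑ i, y (v, i) * x (v, i) = ∑ i, x (v, i) * y (v, i) := fun v =>
        Finset.sum_congr rfl fun i _ => mul_comm _ _
      simp only [hX, hY, Matrix.add_apply, configMatrix_mul_transpose_apply, h4]
      linarith
  have hS : Yᵀ * X = Xᵀ * Y := by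
    have := hsymm.eq
    rw [transpose_mul, transpose_transpose] at this
    exact this.symm
  have h2 : Xᵀ * X * (Xᵀ * Y) + Xᵀ * Y * (Xᵀ * X) = 0 := by
    have : Xᵀ * (X * Yᵀ + Y * Xᵀ) * X = 0 := by rw [h1, Matrix.mul_zero, Matrix.zero_mul]
    rw [Matrix.mul_add, Matrix.add_mul] at this
    simp only [Matrix.mul_assoc] at this ⊢
    rwa [hS] at this
  have h3 : X * (Xᵀ * Y) = 0 := by
    rw [← Matrix.trace_conjTranspose_mul_self_eq_zero_iff,
      Matrix.conjTranspose_eq_transpose_of_trivial, transpose_mul, transpose_mul,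
      transpose_transpose, hS]
    have h7 : ∀ P S : Matrix (Fin k) (Fin k) ℝ, P * S + S * P = 0 → (S * (P * S)).trace = 0 := by
      intro P S hPS
      have h9 : (S * (P * S + S * P)).trace = 0 := by rw [hPS, Matrix.mul_zero, trace_zero]
      rw [Matrix.mul_add, trace_add, Matrix.trace_mul_comm S (S * P), Matrix.mul_assoc S P S] at h9
      linarith
    have h8 : Xᵀ * Y * Xᵀ * (X * (Xᵀ * Y)) = Xᵀ * Y * (Xᵀ * X * (Xᵀ * Y)) := by
      simp only [Matrix.mul_assoc]
    rw [h8]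
    exact h7 _ _ h2
  have h4 : Xᵀ * Y = 0 := mul_eq_zero_of_configMatrix hx h3
  have h5 : X * Yᵀ = 0 := by
    refine Matrix.eq_zero_of_transpose_mul_self ?_
    have := congrArg (fun H => Y * Xᵀ * H) h1
    rw [mul_add, mul_zero, Matrix.mul_assoc Y Xᵀ (Y * Xᵀ), ← Matrix.mul_assoc Xᵀ Y Xᵀ, h4] at this
    simpa [transpose_mul] using this
  have h6 : Yᵀ = 0 := mul_eq_zero_of_configMatrix hx h5
  ext ⟨v, i⟩
  exact congrFun (congrFun h6 i) v

/-- Centred configurations with the same distances differ by an orthogonal matrix. -/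
theorem exists_orthogonalGroup_of_sqDist_eq [Fintype V] {x y : V × Fin k → ℝ}
    (hx0 : ∀ i, ∑ v, x (v, i) = 0) (hy0 : ∀ i, ∑ v, y (v, i) = 0)
    (hx : ∀ a, configMatrix x *ᵥ a = 0 → a = 0) (h : ∀ u w, sqDist u w y = sqDist u w x) :
    ∃ g ∈ Matrix.orthogonalGroup (Fin k) ℝ, configMatrix y = configMatrix x * gᵀ := by
  set X := configMatrix x with hX
  set Y := configMatrix y with hY
  have h1 : X * Xᵀ - Y * Yᵀ = 0 := by
    refine Matrix.eq_zero_of_sum_eq_zero_of_diag_add (fun u => ?_) (fun u w => ?_)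
    · simp only [Matrix.sub_apply, Finset.sum_sub_distrib]
      rw [hX, hY, sum_configMatrix_mul_transpose hy0, sum_configMatrix_mul_transpose hx0, sub_zero]
    · have h3 : ∀ z : V × Fin k → ℝ, sqDist u w z =
          ∑ i, z (u, i) * z (u, i) + ∑ i, z (w, i) * z (w, i) -
            2 * ∑ i, z (u, i) * z (w, i) := by
        intro z
        simp only [sqDist, ← Finset.sum_add_distrib, ← Finset.sum_sub_distrib, Finset.mul_sum]
        exact Finset.sum_congr rfl fun i _ => by ring
      have h2 := h u w
      rw [h3, h3] at h2
      simp only [hX, hY, Matrix.sub_apply, configMatrix_mul_transpose_apply]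
      linarith
  have h2 : Y * Yᵀ = X * Xᵀ := (sub_eq_zero.1 h1).symm
  have hP : IsUnit (Xᵀ * X) := by
    rw [← Matrix.mulVec_injective_iff_isUnit]
    refine (injective_iff_map_eq_zero (Matrix.mulVecLin (Xᵀ * X))).2 fun a ha => hx a ?_
    rw [mulVecLin_apply, ← mulVec_mulVec] at ha
    rw [← dotProduct_self_eq_zero, dotProduct_mulVec, ← mulVec_transpose, ha, zero_dotProduct]
  obtain ⟨P, hP⟩ := hP.exists_left_inv
  let L := P * Xᵀ
  have hL : L * X = 1 := by rw [Matrix.mul_assoc, hP]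
  have hYL : Y = X * (L * Y) := by
    have h3 : (Y - X * (L * Y))ᵀ = 0 := by
      refine Matrix.eq_zero_of_transpose_mul_self ?_
      have h4 : Y * Yᵀ - X * (L * (Y * Yᵀ)) = 0 := by
        rw [h2, ← Matrix.mul_assoc L, hL, Matrix.one_mul, sub_self]
      have h5 : (Y - X * (L * Y)) * (Y - X * (L * Y))ᵀ =
          (Y * Yᵀ - X * (L * (Y * Yᵀ))) - (Y * Yᵀ - X * (L * (Y * Yᵀ))) * (Lᵀ * Xᵀ) := by
        simp only [transpose_sub, transpose_mul, Matrix.sub_mul, Matrix.mul_sub, Matrix.mul_assoc]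
      rw [transpose_transpose, h5, h4, Matrix.zero_mul, sub_zero]
    rw [transpose_eq_zero] at h3
    exact sub_eq_zero.1 h3
  refine ⟨(L * Y)ᵀ, ?_, by rwa [transpose_transpose]⟩
  rw [Matrix.mem_orthogonalGroup_iff', transpose_transpose, transpose_mul, Matrix.mul_assoc,
    ← Matrix.mul_assoc Y, h2, Matrix.mul_assoc X, ← Matrix.mul_assoc L, hL, Matrix.one_mul,
    ← transpose_mul, hL, transpose_one]

end Congruence

section Spanning

variable {V ι : Type*} [DecidableEq V] {d : ℕ}

theorem linearIndependent_sumElim_pairRow_trivialMotion [Fintype V] [Nonempty V] {a b : ι → V}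
    {x : V × Fin d → ℝ} (hx0 : ∀ i, ∑ v, x (v, i) = 0)
    (hx : ∀ a, configMatrix x *ᵥ a = 0 → a = 0)
    (h : LinearIndependent ℝ fun i => pairRow (a i) (b i) x) :
    LinearIndependent ℝ (Sum.elim (fun i => pairRow (a i) (b i) x) fun s => trivialMotion s x) :=
  h.sumElim_of_dotProduct_eq_zero (linearIndependent_trivialMotion hx0 hx)
    fun _ _ => pairRow_dotProduct_trivialMotion _ _ _ _

theorem pairRow_congr_linearMap {k l : ℕ} (u w : V) (x : V × Fin k → ℝ) (y : V × Fin l → ℝ)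
    (C : Matrix (Fin l) (Fin k) ℝ) (h : configMatrix x = configMatrix y * C) :
    configMatrix (pairRow u w x) = configMatrix (pairRow u w y) * C := by
  have hx : ∀ v i, x (v, i) = ∑ j, y (v, j) * C j i := fun v i => congrFun (congrFun h v) i
  ext v i
  simp only [configMatrix, pairRow, of_apply, mul_apply, hx, ← Finset.sum_sub_distrib,
    Finset.mul_sum]
  exact Finset.sum_congr rfl fun j _ => by ring

/-- A centred configuration that is not contained in a hyperplane through the origin, because a
hyperplane does not have enough room for that many independent rows. -/
theorem eq_zero_of_configMatrix_mulVec [Fintype V] [Fintype ι] {a b : ι → V} {x : V × Fin d → ℝ}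
    (hx0 : ∀ i, ∑ v, x (v, i) = 0)
    (h : LinearIndependent ℝ fun i => pairRow (a i) (b i) x)
    (hcard : 2 * (Fintype.card ι + 1) + d * (d + 1) = 2 * (d * Fintype.card V))
    (hV : d + 2 ≤ Fintype.card V) (c : Fin d → ℝ) (hc : configMatrix x *ᵥ c = 0) : c = 0 := by
  by_contra hc0
  have hne : Nonempty V := Fintype.card_pos_iff.1 (by omega)
  let S : Submodule ℝ (Fin d → ℝ) := Submodule.span ℝ (range (configMatrix x))
  have hS : S ≠ ⊤ := fun htop => hc0 (dotProduct_self_eq_zero.1 (dotProduct_eq_zero_of_mem_span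
    (fun v => by rw [dotProduct_comm]; exact congrFun hc v) (htop ▸ Submodule.mem_top : c ∈ S)))
  have hlt : Module.finrank ℝ S < d := by
    have := Submodule.finrank_lt (lt_top_iff_ne_top.2 hS).ne
    rwa [Module.finrank_fin_fun] at this
  let B := Module.finBasis ℝ S
  set r := Module.finrank ℝ S with hr
  have hmem : ∀ v, configMatrix x v ∈ S := fun v => Submodule.subset_span ⟨v, rfl⟩
  let y : V × Fin r → ℝ := fun p => B.repr ⟨configMatrix x p.1, hmem p.1⟩ p.2
  let C : Matrix (Fin r) (Fin d) ℝ := .of fun j => (B j : Fin d → ℝ)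
  have hxy : configMatrix x = configMatrix y * C := by
    ext v i
    have := congrArg (fun s : S => (s : Fin d → ℝ) i) (B.sum_repr ⟨configMatrix x v, hmem v⟩)
    simp only [AddSubmonoidClass.coe_finsetSum, Finset.sum_apply, SetLike.val_smul, Pi.smul_apply,
      smul_eq_mul] at this
    rw [← this]
    rfl
  have hy0 : ∀ j, ∑ v, y (v, j) = 0 := by
    intro j
    have h0 : ∑ v, (⟨configMatrix x v, hmem v⟩ : S) = 0 := by
      ext i
      simp only [AddSubmonoidClass.coe_finsetSum, ZeroMemClass.coe_zero, Pi.zero_apply]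
      exact (Finset.sum_apply i _ _).trans (hx0 i)
    have := congrArg (fun s => B.repr s j) h0
    simpa using this
  have hy : ∀ c, configMatrix y *ᵥ c = 0 → c = 0 := by
    intro c hc
    let φ : S →ₗ[ℝ] ℝ := ∑ j, c j • B.coord j
    have hφ : ∀ s (hs : s ∈ S), φ ⟨s, hs⟩ = 0 := by
      intro s hs
      induction hs using Submodule.span_induction with
      | mem z hz =>
        obtain ⟨v, rfl⟩ := hz
        have := congrFun hc v
        simpa [φ, mulVec, dotProduct, configMatrix, y, mul_comm] using this
      | zero => exact map_zero φ
      | add s t hs ht h1 h2 =>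
        have := map_add φ ⟨s, hs⟩ ⟨t, ht⟩
        rw [h1, h2, add_zero] at this
        exact this
      | smul a s hs h1 =>
        have := map_smul φ a ⟨s, hs⟩
        rw [h1, smul_zero] at this
        exact this
    ext j
    have := hφ (B j) (B j).2
    simpa [φ, Finsupp.single_apply] using this
  let Φ : (V × Fin r → ℝ) →ₗ[ℝ] V × Fin d → ℝ :=
    { toFun := fun z p => ∑ j, z (p.1, j) * C j p.2
      map_add' := fun z z' => by ext p; simp [add_mul, Finset.sum_add_distrib]
      map_smul' := fun a z => by ext p; simp [Finset.mul_sum, mul_assoc] }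
  have hΦ : ∀ u w, Φ (pairRow u w y) = pairRow u w x := by
    intro u w
    ext ⟨v, i⟩
    exact (congrFun (congrFun (pairRow_congr_linearMap u w x y C hxy) v) i).symm
  have hli : LinearIndependent ℝ fun i => pairRow (a i) (b i) y := by
    refine LinearIndependent.of_comp Φ ?_
    convert h using 2 with i
    exact hΦ _ _
  have hle := (linearIndependent_sumElim_pairRow_trivialMotion hy0 hy hli).fintype_card_le_finrank
  rw [Module.finrank_fintype_fun_eq_card, Fintype.card_sum, Fintype.card_prod, Fintype.card_fin]
    at hle
  have h2 := two_mul_card_trivialMotion (k := r)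
  obtain ⟨s, hs⟩ := Nat.exists_eq_add_of_lt hlt
  obtain ⟨m, hm⟩ := Nat.exists_eq_add_of_le hV
  rw [hm] at hle hcard
  rw [hs] at hle hcard
  nlinarith

end Spanning

section GenericConfiguration

variable {V ι : Type*} [Fintype V] [DecidableEq V] {d : ℕ}

theorem D_sqDist (u w : V) (x : V × Fin d → ℝ) :
    KaehlerDifferential.D ℚ ℝ (sqDist u w x) =
      (2 : ℝ) • ∑ a, pairRow u w x a • KaehlerDifferential.D ℚ ℝ (x a) := by
  simp only [Fintype.sum_prod_type_right, sqDist, map_sum, Finset.smul_sum]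
  refine Finset.sum_congr rfl fun i _ => ?_
  simp only [pairRow, sub_mul, sub_smul, smul_sub, Finset.sum_sub_distrib, Pi.single_apply, ite_mul,
    one_mul, zero_mul, ite_smul, zero_smul, smul_ite, smul_zero, Finset.sum_ite_eq',
    Finset.mem_univ, if_true, Derivation.leibniz_pow, map_sub]
  module

theorem sum_smul_D_sqDist [Fintype ι] (a b : ι → V) (c : ι → ℝ) (x : V × Fin d → ℝ) :
    ∑ i, c i • KaehlerDifferential.D ℚ ℝ (sqDist (a i) (b i) x) =
      (2 : ℝ) • ∑ k, (∑ i, c i • pairRow (a i) (b i) x) k • KaehlerDifferential.D ℚ ℝ (x k) := by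
  simp only [D_sqDist, Finset.sum_apply, Pi.smul_apply, smul_eq_mul, Finset.sum_smul,
    Finset.smul_sum, mul_smul]
  rw [Finset.sum_comm]
  refine Finset.sum_congr rfl fun k _ => Finset.sum_congr rfl fun i _ => ?_
  rw [smul_comm]

theorem algebraicIndependent_sqDist [Fintype ι] {a b : ι → V} {x : V × Fin d → ℝ}
    (hx : AlgebraicIndependent ℚ x) (h : LinearIndependent ℝ fun i => pairRow (a i) (b i) x) :
    AlgebraicIndependent ℚ fun i => sqDist (a i) (b i) x := by
  refine .of_linearIndependent_D (Fintype.linearIndependent_iff.2 fun c hc => ?_)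
  rw [sum_smul_D_sqDist] at hc
  have h1 := Fintype.linearIndependent_iff.1 hx.linearIndependent_D _
    ((smul_eq_zero.1 hc).resolve_left two_ne_zero)
  exact Fintype.linearIndependent_iff.1 h c (funext h1)

theorem linearIndependent_pairRow_of_sqDist [Fintype ι] {a b : ι → V} {x : V × Fin d → ℝ}
    (h : AlgebraicIndependent ℚ fun i => sqDist (a i) (b i) x) :
    LinearIndependent ℝ fun i => pairRow (a i) (b i) x := by
  refine Fintype.linearIndependent_iff.2 fun c hc =>
    Fintype.linearIndependent_iff.1 h.linearIndependent_D c ?_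
  rw [sum_smul_D_sqDist, hc]
  simp

end GenericConfiguration

section OrthogonalAction

variable {V : Type*} {d : ℕ}

/-- The action of the orthogonal group on configurations. -/
def orthogonalAction [Fintype V] : Matrix.orthogonalGroup (Fin d) ℝ →*
    ((V × Fin d → ℝ) →L[ℝ] V × Fin d → ℝ) where
  toFun g := LinearMap.toContinuousLinearMap
    { toFun := fun x a => (configMatrix x * (g : Matrix (Fin d) (Fin d) ℝ)ᵀ) a.1 a.2
      map_add' := fun x y => by
        ext a
        exact congrFun (congrFun (Matrix.add_mul (configMatrix x) (configMatrix y) _) a.1) a.2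
      map_smul' := fun c x => by
        ext a
        exact congrFun (congrFun (Matrix.smul_mul c (configMatrix x) _) a.1) a.2 }
  map_one' := by
    ext x a
    change (configMatrix x * (1 : Matrix (Fin d) (Fin d) ℝ)ᵀ) a.1 a.2 = _
    rw [Matrix.transpose_one, Matrix.mul_one]
    rfl
  map_mul' g h := by
    ext x a
    change (configMatrix x * ((g : Matrix (Fin d) (Fin d) ℝ) * (h : Matrix (Fin d) (Fin d) ℝ))ᵀ) a.1 a.2 =
      (configMatrix x * (h : Matrix (Fin d) (Fin d) ℝ)ᵀ * (g : Matrix (Fin d) (Fin d) ℝ)ᵀ) a.1 a.2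
    rw [Matrix.transpose_mul, Matrix.mul_assoc]

variable [Fintype V] (g : Matrix.orthogonalGroup (Fin d) ℝ) (x y : V × Fin d → ℝ)

theorem configMatrix_orthogonalAction : configMatrix (orthogonalAction g x) =
    configMatrix x * (g : Matrix (Fin d) (Fin d) ℝ)ᵀ := rfl

theorem eq_orthogonalAction_iff :
    y = orthogonalAction g x ↔ configMatrix y = configMatrix x * (g : Matrix (Fin d) (Fin d) ℝ)ᵀ :=
  ⟨fun h => h ▸ rfl, fun h => funext fun a => congrFun (congrFun h a.1) a.2⟩

theorem orthogonalAction_apply (v : V) (i : Fin d) :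
    orthogonalAction g x (v, i) = ∑ j, x (v, j) * (g : Matrix (Fin d) (Fin d) ℝ) i j := rfl

theorem sum_orthogonalAction (hx : ∀ i, ∑ v, x (v, i) = 0) (i : Fin d) :
    ∑ v, orthogonalAction g x (v, i) = 0 := by
  simp only [orthogonalAction_apply]
  rw [Finset.sum_comm]
  simp [← Finset.sum_mul, hx]

theorem transpose_mul_orthogonalGroup :
    (g : Matrix (Fin d) (Fin d) ℝ)ᵀ * (g : Matrix (Fin d) (Fin d) ℝ) = 1 := by
  exact (Matrix.mem_orthogonalGroup_iff' (Fin d) ℝ).1 g.2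

theorem dotProduct_mulVec_orthogonalGroup (r s : Fin d → ℝ) :
    ((g : Matrix (Fin d) (Fin d) ℝ) *ᵥ r) ⬝ᵥ ((g : Matrix (Fin d) (Fin d) ℝ) *ᵥ s) = r ⬝ᵥ s := by
  rw [Matrix.dotProduct_mulVec, Matrix.vecMul_mulVec, transpose_mul_orthogonalGroup,
    Matrix.vecMul_one]

theorem orthogonalAction_dotProduct : orthogonalAction g x ⬝ᵥ orthogonalAction g y = x ⬝ᵥ y := by
  simp only [dotProduct, Fintype.sum_prod_type]
  refine Finset.sum_congr rfl fun v _ => ?_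
  have := dotProduct_mulVec_orthogonalGroup g (fun j => x (v, j)) (fun j => y (v, j))
  simp only [dotProduct, mulVec] at this
  rw [← this]
  simp only [orthogonalAction_apply, mul_comm]

theorem sqDist_eq_pairRow [DecidableEq V] (u w : V) : sqDist u w x = pairRow u w x ⬝ᵥ x := by
  rw [pairRow_dotProduct]
  exact Finset.sum_congr rfl fun i _ => sq _

theorem pairRow_orthogonalAction [DecidableEq V] (u w : V) :
    pairRow u w (orthogonalAction g x) = orthogonalAction g (pairRow u w x) :=
  (eq_orthogonalAction_iff _ _ _).2
    (pairRow_congr_linearMap u w _ x _ (configMatrix_orthogonalAction g x))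

theorem sqDist_orthogonalAction [DecidableEq V] (u w : V) :
    sqDist u w (orthogonalAction g x) = sqDist u w x := by
  rw [sqDist_eq_pairRow, pairRow_orthogonalAction, orthogonalAction_dotProduct, ← sqDist_eq_pairRow]

theorem trivialMotion_orthogonalAction_dotProduct
    (h : ∀ s, trivialMotion s x ⬝ᵥ y = 0) (s) :
    trivialMotion s (orthogonalAction g x) ⬝ᵥ orthogonalAction g y = 0 := by
  rw [forall_trivialMotion_dotProduct_eq_zero_iff] at h
  refine (forall_trivialMotion_dotProduct_eq_zero_iff _ _).2
    ⟨sum_orthogonalAction g y h.1, ?_⟩ s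
  rw [configMatrix_orthogonalAction, configMatrix_orthogonalAction, Matrix.transpose_mul,
    Matrix.transpose_transpose, Matrix.mul_assoc, ← Matrix.mul_assoc (configMatrix y)ᵀ,
    Matrix.IsSymm, Matrix.transpose_mul, Matrix.transpose_mul, h.2.eq, Matrix.transpose_transpose,
    Matrix.mul_assoc]

theorem eq_one_of_orthogonalAction_eq (hx : ∀ a, configMatrix x *ᵥ a = 0 → a = 0)
    (h : orthogonalAction g x = x) : g = 1 := by
  have h1 := (eq_orthogonalAction_iff g x x).1 h.symm
  have h2 : configMatrix x * ((g : Matrix (Fin d) (Fin d) ℝ)ᵀ - 1) = 0 := by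
    rw [Matrix.mul_sub, ← h1, Matrix.mul_one, sub_self]
  have h3 := sub_eq_zero.1 (mul_eq_zero_of_configMatrix hx h2)
  exact Subtype.ext (by simpa using congrArg Matrix.transpose h3)

end OrthogonalAction

section Derivative

variable {V : Type*} [Fintype V] {d : ℕ}

theorem contDiff_sqDist (u w : V) : ContDiff ℝ 1 (sqDist (V := V) (k := d) u w) := by
  unfold sqDist
  fun_prop

theorem contDiff_pairRow [DecidableEq V] (u w : V) : ContDiff ℝ 1 (pairRow (V := V) (k := d) u w) := by
  unfold pairRow
  fun_prop

theorem contDiff_trivialMotion (s) : ContDiff ℝ 1 (trivialMotion (V := V) (k := d) s) := by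
  rcases s with i | ij
  · unfold trivialMotion
    fun_prop
  · unfold trivialMotion
    fun_prop

variable [DecidableEq V]

theorem hasDerivAt_sqDist {γ : ℝ → V × Fin d → ℝ} {γ' : V × Fin d → ℝ} {t : ℝ}
    (h : HasDerivAt γ γ' t) (u w : V) :
    HasDerivAt (fun t => sqDist u w (γ t)) (2 * (pairRow u w (γ t) ⬝ᵥ γ')) t := by
  have h1 := hasDerivAt_pi.1 h
  rw [pairRow_dotProduct, Finset.mul_sum]
  refine HasDerivAt.fun_sum fun i _ => ?_
  refine (((h1 (u, i)).sub (h1 (w, i))).fun_pow 2).congr_deriv ?_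
  simp
  ring

theorem fderiv_sqDist_apply (u w : V) (x y : V × Fin d → ℝ) :
    fderiv ℝ (sqDist u w) x y = 2 * (pairRow u w x ⬝ᵥ y) := by
  have h1 : HasDerivAt (fun t : ℝ => x + t • y) y 0 := by
    simpa using ((hasDerivAt_id (0 : ℝ)).smul_const y).const_add x
  have h2 := hasDerivAt_sqDist h1 u w
  have h3 : HasFDerivAt (sqDist u w) (fderiv ℝ (sqDist u w) x)
      (x + (0 : ℝ) • y) := by
    simpa using ((contDiff_sqDist u w).differentiable one_ne_zero x).hasFDerivAt
  have h4 := h3.comp_hasDerivAt (0 : ℝ) h1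
  simpa using h4.unique h2

theorem sqDist_sub_sqDist (u w : V) (x y : V × Fin d → ℝ) :
    sqDist u w x - sqDist u w y = 2 * (pairRow u w (midpoint ℝ x y) ⬝ᵥ (x - y)) := by
  rw [pairRow_dotProduct, sqDist, sqDist, ← Finset.sum_sub_distrib, Finset.mul_sum]
  refine Finset.sum_congr rfl fun i _ => ?_
  simp [midpoint_eq_smul_add]
  ring

end Derivative

section Realizations

variable {V ι : Type*} [Fintype V] {d : ℕ}

/-- The centred configurations with the same edge lengths as `p`. -/
def centredRealizations (a b : ι → V) (p : V × Fin d → ℝ) : Set (V × Fin d → ℝ) :=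
  {x | (∀ i, sqDist (a i) (b i) x = sqDist (a i) (b i) p) ∧ ∀ j, ∑ v, x (v, j) = 0}

variable {a b : ι → V} {p : V × Fin d → ℝ}

theorem exists_abs_sub_le_of_eqvGen {u w : V}
    (h : Relation.EqvGen (fun u w => ∃ i, u = a i ∧ w = b i) u w) :
    ∃ R, ∀ x ∈ centredRealizations a b p, ∀ j, |x (u, j) - x (w, j)| ≤ R := by
  induction h with
  | rel u w h =>
    obtain ⟨i, rfl, rfl⟩ := h
    refine ⟨√(sqDist (a i) (b i) p), fun x hx j => Real.abs_le_sqrt ?_⟩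
    rw [← hx.1 i]
    exact Finset.single_le_sum (f := fun j => (x (a i, j) - x (b i, j)) ^ 2)
      (fun j _ => sq_nonneg _) (Finset.mem_univ j)
  | refl u => exact ⟨0, fun x _ j => by simp⟩
  | symm u w _ ih =>
    obtain ⟨R, hR⟩ := ih
    exact ⟨R, fun x hx j => by rw [abs_sub_comm]; exact hR x hx j⟩
  | trans u w z _ _ ih1 ih2 =>
    obtain ⟨R, hR⟩ := ih1
    obtain ⟨R', hR'⟩ := ih2
    exact ⟨R + R', fun x hx j => (abs_sub_le _ _ _).trans (add_le_add (hR x hx j) (hR' x hx j))⟩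

theorem isCompact_centredRealizations
    (hconn : ∀ u w, Relation.EqvGen (fun u w => ∃ i, u = a i ∧ w = b i) u w) :
    IsCompact (centredRealizations a b p) := by
  choose R hR using fun u w => exists_abs_sub_le_of_eqvGen (d := d) (p := p) (hconn u w)
  refine (isCompact_univ_pi fun k : V × Fin d =>
    isCompact_Icc (a := -∑ w, R k.1 w) (b := ∑ w, R k.1 w)).of_isClosed_subset ?_ ?_
  · have h : centredRealizations a b p = (⋂ i, {x | sqDist (a i) (b i) x = sqDist (a i) (b i) p}) ∩
        ⋂ j, {x | ∑ v, x (v, j) = 0} := by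
      ext x
      simp [centredRealizations]
    rw [h]
    exact (isClosed_iInter fun i => isClosed_eq (contDiff_sqDist _ _).continuous
      continuous_const).inter (isClosed_iInter fun j => isClosed_eq (by fun_prop) continuous_const)
  · rintro x hx ⟨u, j⟩ -
    rw [mem_Icc, ← abs_le]
    have h1 : (Fintype.card V : ℝ) * x (u, j) = ∑ w, (x (u, j) - x (w, j)) := by
      rw [Finset.sum_sub_distrib, hx.2 j]
      simp
    have h2 : (Fintype.card V : ℝ) * |x (u, j)| ≤ ∑ w, R u w := by
      rw [← Nat.abs_cast, ← abs_mul, h1]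
      exact (Finset.abs_sum_le_sum_abs _ _).trans (Finset.sum_le_sum fun w _ => hR u w x hx j)
    have h3 : (1 : ℝ) ≤ Fintype.card V := by
      exact_mod_cast Fintype.card_pos_iff.2 ⟨u⟩
    nlinarith [abs_nonneg (x (u, j))]

theorem orthogonalAction_mem_centredRealizations [DecidableEq V]
    (g : Matrix.orthogonalGroup (Fin d) ℝ) {x : V × Fin d → ℝ}
    (hx : x ∈ centredRealizations a b p) : orthogonalAction g x ∈ centredRealizations a b p :=
  ⟨fun i => by rw [sqDist_orthogonalAction, hx.1 i], sum_orthogonalAction g x hx.2⟩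

theorem mem_centredRealizations_of_hasDerivAt [DecidableEq V]
    {w : (V × Fin d → ℝ) → V × Fin d → ℝ} (hw1 : ∀ i x, pairRow (a i) (b i) x ⬝ᵥ w x = 0)
    (hw2 : ∀ s x, trivialMotion s x ⬝ᵥ w x = 0) (γ : ℝ → V × Fin d → ℝ)
    (hγ : ∀ t, HasDerivAt γ (w (γ t)) t) (h0 : γ 0 ∈ centredRealizations a b p) (t : ℝ) :
    γ t ∈ centredRealizations a b p := by
  constructor
  · intro i
    rw [← h0.1 i]
    have h1 : ∀ t, HasDerivAt (fun t => sqDist (a i) (b i) (γ t)) 0 t := fun t => by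
      simpa [hw1] using hasDerivAt_sqDist (hγ t) (a i) (b i)
    exact is_const_of_deriv_eq_zero (fun t => (h1 t).differentiableAt) (fun t => (h1 t).deriv) t 0
  · intro j
    rw [← h0.2 j]
    have h1 : ∀ t, HasDerivAt (fun t => ∑ v, γ t (v, j)) 0 t := fun t => by
      have := HasDerivAt.fun_sum fun v (_ : v ∈ Finset.univ) => hasDerivAt_pi.1 (hγ t) (v, j)
      rwa [← trivialMotion_inl_dotProduct j (γ t), hw2] at this
    exact is_const_of_deriv_eq_zero (fun t => (h1 t).differentiableAt) (fun t => (h1 t).deriv) t 0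

/-- Near a configuration `z` with `d n - d (d + 1) / 2` independent rows, the lengths of the
corresponding pairs determine a centred configuration up to an orthogonal transformation. -/
theorem exists_nhds_forall_eq_orthogonalAction {κ : Type*} [Fintype κ] [DecidableEq V]
    {a b : κ → V} {z : V × Fin d → ℝ}
    (hz : LinearIndependent ℝ
      (Sum.elim (fun i => pairRow (a i) (b i) z) fun s => trivialMotion s z))
    (hcard : Fintype.card κ + Fintype.card (Fin d ⊕ {ij : Fin d × Fin d // ij.1 < ij.2}) =
      Fintype.card (V × Fin d)) :
    ∃ U ∈ 𝓝 z, ∀ x ∈ U, ∀ y ∈ U, (∀ i, ∑ v, x (v, i) = 0) → (∀ i, ∑ v, y (v, i) = 0) →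
      (∀ c, configMatrix x *ᵥ c = 0 → c = 0) →
      (∀ i, sqDist (a i) (b i) x = sqDist (a i) (b i) y) → ∃ g, y = orthogonalAction g x := by
  have hcont : Continuous fun z : V × Fin d → ℝ =>
      Sum.elim (fun i => pairRow (a i) (b i) z) fun s => trivialMotion s z := by
    refine continuous_pi fun s => ?_
    rcases s with i | s
    · exact (contDiff_pairRow (a i) (b i)).continuous
    · exact (contDiff_trivialMotion s).continuous
  obtain ⟨ε, hε, hball⟩ := Metric.mem_nhds_iff.1
    (hcont.continuousAt.preimage_mem_nhds (isOpen_setOfPred_linearIndependent.mem_nhds hz))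
  refine ⟨Metric.ball z ε, Metric.ball_mem_nhds z hε, fun x hx y hy hx0 hy0 hxr hxy => ?_⟩
  have hm := hball ((convex_ball z ε).midpoint_mem hx hy)
  have hδ : ∀ u w, pairRow u w (midpoint ℝ x y) ⬝ᵥ (x - y) = 0 := fun u w =>
    LinearIndependent.dotProduct_eq_zero_of_sumElim hm hcard
      (fun i j => pairRow_dotProduct_trivialMotion _ _ _ _)
      (fun j => pairRow_dotProduct_trivialMotion _ _ _ _) fun i => by
        have := sqDist_sub_sqDist (a i) (b i) x y
        rw [hxy, sub_self] at this
        linarith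
  obtain ⟨g, hg, h⟩ := exists_orthogonalGroup_of_sqDist_eq hx0 hy0 hxr fun u w => by
    have := sqDist_sub_sqDist u w x y
    rw [hδ] at this
    linarith
  exact ⟨⟨g, hg⟩, (eq_orthogonalAction_iff _ _ _).2 h⟩

end Realizations

section SecondRealization

variable {V ι : Type*} [Fintype V] [Fintype ι] [DecidableEq V] {d : ℕ}

theorem exists_mem_centredRealizations_ne_orthogonalAction {a b : ι → V} {a₀ b₀ : V}
    {p : V × Fin d → ℝ}
    (hconn : ∀ u w, Relation.EqvGen (fun u w => ∃ i, u = a i ∧ w = b i) u w)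
    (hcard : 2 * (Fintype.card ι + 1) + d * (d + 1) = 2 * (d * Fintype.card V))
    (hV : d + 2 ≤ Fintype.card V)
    (hind : ∀ x ∈ centredRealizations a b p, LinearIndependent ℝ fun i => pairRow (a i) (b i) x)
    (hp0 : ∀ j, ∑ v, p (v, j) = 0)
    (hp : LinearIndependent ℝ fun o : Option ι => pairRow (o.elim a₀ a) (o.elim b₀ b) p) :
    ∃ q ∈ centredRealizations a b p, sqDist a₀ b₀ q = sqDist a₀ b₀ p ∧
      ∀ g, q ≠ orthogonalAction g p := by
  have hne : Nonempty V := Fintype.card_pos_iff.1 (by omega)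
  set M := centredRealizations a b p with hM
  have hpM : p ∈ M := ⟨fun _ => rfl, hp0⟩
  have hMc : IsCompact M := isCompact_centredRealizations hconn
  have hspan : ∀ x ∈ M, ∀ c, configMatrix x *ᵥ c = 0 → c = 0 := fun x hx =>
    eq_zero_of_configMatrix_mulVec hx.2 (hind x hx) hcard hV
  let c : ι ⊕ (Fin d ⊕ {ij : Fin d × Fin d // ij.1 < ij.2}) → (V × Fin d → ℝ) → V × Fin d → ℝ :=
    Sum.elim (fun i x => pairRow (a i) (b i) x) fun s x => trivialMotion s x
  have hcx : ∀ x, (fun s => c s x) =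
      Sum.elim (fun i => pairRow (a i) (b i) x) fun s => trivialMotion s x := fun x => by
    ext (i | s) <;> rfl
  have hT := two_mul_card_trivialMotion (k := d)
  have hκ : Fintype.card (V × Fin d) = d * Fintype.card V := by
    rw [Fintype.card_prod, Fintype.card_fin, mul_comm]
  have hcard1 : Fintype.card (ι ⊕ (Fin d ⊕ {ij : Fin d × Fin d // ij.1 < ij.2})) + 1 =
      Fintype.card (V × Fin d) := by
    rw [Fintype.card_sum, hκ]
    omega
  have hcard2 : Fintype.card (Option ι) +
      Fintype.card (Fin d ⊕ {ij : Fin d × Fin d // ij.1 < ij.2}) = Fintype.card (V × Fin d) := by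
    rw [Fintype.card_option, hκ]
    omega
  have hcli : ∀ x ∈ M, LinearIndependent ℝ fun s => c s x := fun x hx => by
    rw [hcx]
    exact linearIndependent_sumElim_pairRow_trivialMotion hx.2 (hspan x hx) (hind x hx)
  obtain ⟨w, K, C, hwK, hwC, hcw, hw1⟩ := exists_lipschitzWith_unit_orthogonal (c := c)
    (by
      rintro (i | s)
      · exact contDiff_pairRow _ _
      · exact contDiff_trivialMotion s) hcard1 hMc hcli
  have hrow : ∀ i x, pairRow (a i) (b i) x ⬝ᵥ w x = 0 := fun i x => hcw (.inl i) x
  have htriv : ∀ s x, trivialMotion s x ⬝ᵥ w x = 0 := fun s x => hcw (.inr s) x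
  have hw0 : ∀ x ∈ M, w x ≠ 0 := fun x hx h => by
    have := hw1 x hx
    simp [h] at this
  have hbasis : ∀ a₁ b₁, ∀ z ∈ M, LinearIndependent ℝ
      (fun o : Option ι => pairRow (o.elim a₁ a) (o.elim b₁ b) z) → LinearIndependent ℝ
      (Sum.elim (fun o : Option ι => pairRow (o.elim a₁ a) (o.elim b₁ b) z)
        fun s => trivialMotion s z) := fun a₁ b₁ z hz h =>
    linearIndependent_sumElim_pairRow_trivialMotion (a := fun o : Option ι => o.elim a₁ a)
      (b := fun o : Option ι => o.elim b₁ b) hz.2 (hspan z hz) h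
  refine exists_mem_ne_map (ρ := orthogonalAction (V := V) (d := d)) (M := M)
    (h := sqDist a₀ b₀) (h' := fderiv ℝ (sqDist a₀ b₀) p) hwK hwC hMc
    (mem_centredRealizations_of_hasDerivAt hrow htriv) hw0
    (fun g x hx => orthogonalAction_mem_centredRealizations g hx) (fun g x hx => ?_)
    (fun g x hx h => eq_one_of_orthogonalAction_eq g x (hspan x hx) h) (fun z hz => ?_) hpM
    (contDiff_sqDist a₀ b₀).continuous
    ((contDiff_sqDist a₀ b₀).differentiable one_ne_zero p).hasFDerivAt
    (fun g x _ => sqDist_orthogonalAction g x a₀ b₀) ?_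
  · have hgx := orthogonalAction_mem_centredRealizations g hx
    refine (hcli _ hgx).eq_or_eq_neg_of_dotProduct_eq_zero hcard1 (fun s => hcw s _) ?_
      (hw1 _ hgx) (by rw [orthogonalAction_dotProduct, hw1 x hx])
    rintro (i | s)
    · change pairRow (a i) (b i) (orthogonalAction g x) ⬝ᵥ _ = 0
      rw [pairRow_orthogonalAction, orthogonalAction_dotProduct, hrow]
    · exact trivialMotion_orthogonalAction_dotProduct g x (w x) (fun s => htriv s x) s
  · obtain ⟨a₁, b₁, h1⟩ : ∃ a₁ b₁, pairRow a₁ b₁ z ⬝ᵥ w z ≠ 0 := by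
      by_contra! h
      exact hw0 z hz (eq_zero_of_forall_pairRow_dotProduct hz.2 (hspan z hz)
        (fun s => htriv s z) h)
    refine ⟨sqDist a₁ b₁, fderiv ℝ (sqDist a₁ b₁) z,
      (contDiff_sqDist a₁ b₁).contDiffAt.hasStrictFDerivAt one_ne_zero,
      by rw [fderiv_sqDist_apply]; exact mul_ne_zero two_ne_zero h1, ?_⟩
    have hli : LinearIndependent ℝ
        (fun o : Option ι => pairRow (o.elim a₁ a) (o.elim b₁ b) z) := by
      refine linearIndependent_option.2 ⟨hind z hz, fun hmem => h1 ?_⟩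
      rw [dotProduct_comm]
      exact dotProduct_eq_zero_of_mem_span (fun i => by rw [dotProduct_comm]; exact hrow i z) hmem
    obtain ⟨U, hU, h⟩ := exists_nhds_forall_eq_orthogonalAction (hbasis a₁ b₁ z hz hli) hcard2
    refine ⟨U, hU, fun x hx y hy hxy =>
      h x hx.1 y hy.1 hx.2.2 hy.2.2 (hspan x hx.2) fun o => ?_⟩
    rcases o with _ | i
    · exact hxy
    · exact (hx.2.1 i).trans (hy.2.1 i).symm
  · rw [fderiv_sqDist_apply]
    refine mul_ne_zero two_ne_zero fun h => hw0 p hpM ?_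
    refine (hbasis a₀ b₀ p hpM hp).eq_zero_of_dotProduct_eq_zero
      (by rw [Fintype.card_sum, hcard2]) ?_
    rintro (o | s)
    · rcases o with _ | i
      · exact h
      · exact hrow i p
    · exact htriv s p

end SecondRealization

section PartialReflection

variable {V : Type*} {d : ℕ}

theorem AlgebraicIndependent.sum_sub_mul_sub_ne_zero {x : V × Fin d → ℝ}
    (hx : AlgebraicIndependent ℚ x) (hd : d ≠ 0) {a z c : V} (ha : a ≠ c) (hz : z ≠ c) :
    ∑ i, (x (c, i) - x (a, i)) * (x (c, i) - x (z, i)) ≠ 0 := by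
  classical
  intro h
  let P : MvPolynomial (V × Fin d) ℚ := ∑ i, (.X (c, i) - .X (a, i)) * (.X (c, i) - .X (z, i))
  have hP : P = 0 := (injective_iff_map_eq_zero _).1 hx P (by simpa [P] using h)
  have := congrArg (MvPolynomial.eval fun k : V × Fin d => if k.1 = c then (0 : ℚ) else 1) hP
  simp [P, ha, hz, hd] at this

/-- The configuration obtained by reflecting the points indexed by `T` in the point `c`. -/
def partialReflection (T : Set V) [DecidablePred (· ∈ T)] (c : V) (x : V × Fin d → ℝ) :
    V × Fin d → ℝ := fun k => if k.1 ∈ T then 2 * x (c, k.2) - x k else x k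

variable (T : Set V) [DecidablePred (· ∈ T)]

theorem sqDist_partialReflection [Fintype V] {c u w : V} (x : V × Fin d → ℝ)
    (h : (u ∈ T ↔ w ∈ T) ∨ u = c ∨ w = c) :
    sqDist u w (partialReflection T c x) = sqDist u w x := by
  refine Finset.sum_congr rfl fun i _ => ?_
  simp only [partialReflection]
  by_cases hu : u ∈ T <;> by_cases hw : w ∈ T <;> simp only [hu, hw, if_true, if_false]
  · ring
  · rcases h with h | rfl | rfl
    · exact absurd (h.1 hu) hw
    · ring
    · ring
  · rcases h with h | rfl | rfl
    · exact absurd (h.2 hw) hu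
    · ring
    · ring

theorem sqDist_partialReflection_ne [Fintype V] {x : V × Fin d → ℝ}
    (hx : AlgebraicIndependent ℚ x) (hd : d ≠ 0) {a z c : V} (ha : a ∈ T) (hz : z ∉ T)
    (hac : a ≠ c) (hzc : z ≠ c) :
    sqDist a z (partialReflection T c x) ≠ sqDist a z x := by
  intro h
  refine hx.sum_sub_mul_sub_ne_zero hd hac hzc ?_
  have h1 : sqDist a z (partialReflection T c x) - sqDist a z x =
      4 * ∑ i, (x (c, i) - x (a, i)) * (x (c, i) - x (z, i)) := by
    simp only [sqDist, ← Finset.sum_sub_distrib, Finset.mul_sum, partialReflection, ha, hz,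
      if_true, if_false]
    exact Finset.sum_congr rfl fun i _ => by ring
  linarith

end PartialReflection

section Equivalent

variable {V ι : Type*} [Fintype V] {d : ℕ}

theorem exists_forall_sqDist_eq_of_not_eqvGen {a b : ι → V} {a₀ b₀ : V} {x : V × Fin d → ℝ}
    (hx : AlgebraicIndependent ℚ x) (hd : d ≠ 0) (hV : 3 ≤ Fintype.card V) (hab : a₀ ≠ b₀)
    (hconn : ¬ ∀ u w, Relation.EqvGen (fun u w => ∃ i, u = a i ∧ w = b i) u w) :
    ∃ q : V × Fin d → ℝ, (∀ i, sqDist (a i) (b i) q = sqDist (a i) (b i) x) ∧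
      sqDist a₀ b₀ q = sqDist a₀ b₀ x ∧ ∃ u w, sqDist u w q ≠ sqDist u w x := by
  classical
  push Not at hconn
  obtain ⟨u, w, huw⟩ := hconn
  let T : Set V := {v | Relation.EqvGen (fun u w => ∃ i, u = a i ∧ w = b i) u v}
  have hT : ∀ i, a i ∈ T ↔ b i ∈ T := fun i =>
    ⟨fun h => .trans _ _ _ h (.rel _ _ ⟨i, rfl, rfl⟩),
      fun h => .trans _ _ _ h (.symm _ _ (.rel _ _ ⟨i, rfl, rfl⟩))⟩
  have huT : u ∈ T := .refl u
  have hwT : w ∉ T := huw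
  obtain ⟨v, hva, hvb⟩ : ∃ v, v ≠ a₀ ∧ v ≠ b₀ := by
    by_contra! h
    have h1 : Finset.univ ⊆ ({a₀, b₀} : Finset V) := fun v _ => by
      by_cases hv : v = a₀
      · simp [hv]
      · simp [h v hv]
    have h2 := (Finset.card_le_card h1).trans Finset.card_le_two
    rw [Finset.card_univ] at h2
    omega
  obtain ⟨c, y, z, hc, hy, hz, hyc, hzc⟩ : ∃ c y z, (a₀ = c ∨ b₀ = c) ∧ y ∈ T ∧ z ∉ T ∧
      y ≠ c ∧ z ≠ c := by
    by_cases hv : v ∈ T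
    · by_cases hw : w = a₀
      · exact ⟨b₀, v, w, .inr rfl, hv, hwT, hvb, hw ▸ hab⟩
      · exact ⟨a₀, v, w, .inl rfl, hv, hwT, hva, hw⟩
    · by_cases hu : u = a₀
      · exact ⟨b₀, u, v, .inr rfl, huT, hv, hu ▸ hab, hvb⟩
      · exact ⟨a₀, u, v, .inl rfl, huT, hv, hu, hva⟩
  exact ⟨partialReflection T c x, fun i => sqDist_partialReflection T x (.inl (hT i)),
    sqDist_partialReflection T x (.inr hc), y, z,
    sqDist_partialReflection_ne T hx hd hy hz hyc hzc⟩

/-- The translate of a configuration that has its barycentre at the origin. -/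
def centred (x : V × Fin d → ℝ) : V × Fin d → ℝ := fun k =>
  x k - (∑ v, x (v, k.2)) / Fintype.card V

theorem pairRow_centred [DecidableEq V] (u w : V) (x : V × Fin d → ℝ) :
    pairRow u w (centred x) = pairRow u w x := by
  ext k
  simp [pairRow, centred]

theorem sqDist_centred (u w : V) (x : V × Fin d → ℝ) : sqDist u w (centred x) = sqDist u w x := by
  simp [sqDist, centred]

theorem sum_centred [Nonempty V] (x : V × Fin d → ℝ) (i : Fin d) : ∑ v, centred x (v, i) = 0 := by
  simp only [centred, Finset.sum_sub_distrib, Finset.sum_const, Finset.card_univ, nsmul_eq_mul]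
  field_simp
  ring

theorem exists_forall_sqDist_eq_of_eqvGen [Fintype ι] [DecidableEq V] {a b : ι → V} {a₀ b₀ : V} {x : V × Fin d → ℝ}
    (hx : AlgebraicIndependent ℚ x)
    (hcard : 2 * (Fintype.card ι + 1) + d * (d + 1) = 2 * (d * Fintype.card V))
    (hV : d + 2 ≤ Fintype.card V)
    (hconn : ∀ u w, Relation.EqvGen (fun u w => ∃ i, u = a i ∧ w = b i) u w)
    (hli : LinearIndependent ℝ fun o : Option ι => pairRow (o.elim a₀ a) (o.elim b₀ b) x) :
    ∃ q : V × Fin d → ℝ, (∀ i, sqDist (a i) (b i) q = sqDist (a i) (b i) x) ∧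
      sqDist a₀ b₀ q = sqDist a₀ b₀ x ∧ ∃ u w, sqDist u w q ≠ sqDist u w x := by
  have hne : Nonempty V := Fintype.card_pos_iff.1 (by omega)
  have halg : AlgebraicIndependent ℚ fun i => sqDist (a i) (b i) x :=
    algebraicIndependent_sqDist hx (hli.comp some (Option.some_injective ι))
  have hind : ∀ y ∈ centredRealizations a b (centred x),
      LinearIndependent ℝ fun i => pairRow (a i) (b i) y := fun y hy => by
    refine linearIndependent_pairRow_of_sqDist ?_
    simpa only [hy.1, sqDist_centred] using halg
  have hx0 := sum_centred x
  obtain ⟨q, hqM, hq0, hq⟩ := exists_mem_centredRealizations_ne_orthogonalAction (a₀ := a₀)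
    (b₀ := b₀) hconn hcard hV hind hx0 (by simpa only [pairRow_centred] using hli)
  simp only [sqDist_centred] at hq0
  refine ⟨q, fun i => by rw [hqM.1, sqDist_centred], hq0, ?_⟩
  by_contra! h
  obtain ⟨g, hg, hgq⟩ := exists_orthogonalGroup_of_sqDist_eq hx0 hqM.2
    (eq_zero_of_configMatrix_mulVec hx0 (hind _ ⟨fun _ => rfl, hx0⟩) hcard hV)
    fun u w => by rw [h, sqDist_centred]
  exact hq ⟨g, hg⟩ ((eq_orthogonalAction_iff _ _ _).2 hgq)

end Equivalent

section Framework

variable {V : Type*} {d : ℕ}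

theorem rigidityMatrix_eq_pairRow [DecidableEq V] {G : SimpleGraph V}
    (p : V → EuclideanSpace ℝ (Fin d)) (e : G.edgeSet) {a b : V} (h : (e : Sym2 V) = s(a, b)) :
    rigidityMatrix G p e = pairRow a b fun k => p k.1 k.2 := by
  have hab : a ≠ b := G.ne_of_adj (by rw [← SimpleGraph.mem_edgeSet, ← h]; exact e.2)
  ext ⟨v, i⟩
  simp only [rigidityMatrix, pairRow]
  split_ifs with hv
  · have hs := Sym2.other_spec hv
    generalize Sym2.Mem.other hv = w at hs
    rw [h, Sym2.eq_iff] at hs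
    rcases hs with ⟨rfl, rfl⟩ | ⟨rfl, rfl⟩
    · simp [hab]
    · simp [hab]
  · rw [h, Sym2.mem_iff, not_or] at hv
    simp [hv.1, hv.2]

theorem Isostatic.linearIndependent [Fintype V] [DecidableEq V] {G : SimpleGraph V} [DecidableRel G.Adj]
    {p : V → EuclideanSpace ℝ (Fin d)} (h : Isostatic G p) :
    LinearIndependent ℝ fun e => rigidityMatrix G p e := by
  have h1 := h.1.2.trans h.2.symm
  rw [Matrix.rank_eq_finrank_span_row] at h1
  exact linearIndependent_iff_card_eq_finrank_span.2 h1.symm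

theorem Isostatic.two_mul_card_edgeSet [Fintype V] [DecidableEq V] {G : SimpleGraph V} [DecidableRel G.Adj]
    {p : V → EuclideanSpace ℝ (Fin d)} (h : Isostatic G p) (hV : d + 2 ≤ Fintype.card V) :
    2 * Fintype.card G.edgeSet + d * (d + 1) = 2 * (d * Fintype.card V) := by
  have h1 := Nat.div_mul_cancel (Nat.even_mul_succ_self d).two_dvd
  have h2 : d * (d + 2) ≤ d * Fintype.card V := Nat.mul_le_mul_left d hV
  have h3 : d * (d + 1) ≤ d * (d + 2) := Nat.mul_le_mul_left d (by omega)
  rw [h.2]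
  omega

theorem EuclideanSpace.dist_eq_sqrt_sqDist (p : V → EuclideanSpace ℝ (Fin d)) (u w : V) :
    dist (p u) (p w) = √(sqDist u w fun k => p k.1 k.2) := by
  rw [EuclideanSpace.dist_eq]
  simp only [Real.dist_eq, sq_abs, sqDist]

end Framework

/-- A generic isostatic framework on at least `d + 2` vertices in ℝ^d is not globally
rigid: there is a configuration `q` equivalent to `p` (same lengths on all edges) but
not congruent to `p` (not the same distances on all pairs of vertices). -/
theorem generic_isostatic_not_globally_rigid
    {V : Type*} [Fintype V] [DecidableEq V] {d : ℕ} (hd : 1 ≤ d)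
    (G : SimpleGraph V) [DecidableRel G.Adj] (hV : d + 2 ≤ Fintype.card V)
    (p : V → EuclideanSpace ℝ (Fin d))
    (hgen : IsGenericConfig d p) (hiso : Isostatic G p) :
    ∃ q : V → EuclideanSpace ℝ (Fin d),
      (∀ ⦃u w : V⦄, G.Adj u w → dist (q u) (q w) = dist (p u) (p w)) ∧
      ¬ (∀ u w : V, dist (q u) (q w) = dist (p u) (p w)) := by
  classical
  set x : V × Fin d → ℝ := fun k => p k.1 k.2 with hx
  have hrep : ∀ e : G.edgeSet, ∃ a b, (e : Sym2 V) = s(a, b) := fun e =>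
    Sym2.ind (fun a b => ⟨a, b, rfl⟩) (e : Sym2 V)
  choose a b hab using hrep
  have hli : LinearIndependent ℝ fun e => pairRow (a e) (b e) x := by
    convert hiso.linearIndependent using 2 with e
    exact (rigidityMatrix_eq_pairRow p e (hab e)).symm
  have hcard := hiso.two_mul_card_edgeSet hV
  obtain ⟨e₀⟩ : Nonempty G.edgeSet := by
    refine Fintype.card_pos_iff.1 ?_
    nlinarith
  let ι := {e : G.edgeSet // e ≠ e₀}
  have hι : Fintype.card ι + 1 = Fintype.card G.edgeSet := by
    rw [← Fintype.card_option]
    exact Fintype.card_congr (Equiv.optionSubtypeNe e₀)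
  obtain ⟨q, hq, hq0, u, w, huw⟩ : ∃ q : V × Fin d → ℝ,
      (∀ i : ι, sqDist (a i) (b i) q = sqDist (a i) (b i) x) ∧
        sqDist (a e₀) (b e₀) q = sqDist (a e₀) (b e₀) x ∧ ∃ u w, sqDist u w q ≠ sqDist u w x := by
    by_cases hconn : ∀ u w, Relation.EqvGen (fun u w => ∃ i : ι, u = a i ∧ w = b i) u w
    · refine exists_forall_sqDist_eq_of_eqvGen hgen (by rw [hι, hcard]) hV hconn ?_
      convert hli.comp _ (Equiv.optionSubtypeNe e₀).injective using 2 with o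
      rcases o with _ | i <;> simp
    · exact exists_forall_sqDist_eq_of_not_eqvGen hgen (by omega) (by omega)
        (G.ne_of_adj (by rw [← SimpleGraph.mem_edgeSet, ← hab]; exact e₀.2)) hconn
  have hqe : ∀ e, sqDist (a e) (b e) q = sqDist (a e) (b e) x := fun e => by
    by_cases he : e = e₀
    · rw [he, hq0]
    · exact hq ⟨e, he⟩
  refine ⟨fun v => WithLp.toLp 2 fun i => q (v, i), fun u w hadj => ?_, fun h => huw ?_⟩
  · rw [EuclideanSpace.dist_eq_sqrt_sqDist, EuclideanSpace.dist_eq_sqrt_sqDist]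
    have h1 := hab ⟨s(u, w), hadj⟩
    have h2 := hqe ⟨s(u, w), hadj⟩
    generalize a ⟨s(u, w), hadj⟩ = c at h1 h2
    generalize b ⟨s(u, w), hadj⟩ = f at h1 h2
    congr 1
    rcases Sym2.eq_iff.1 h1 with ⟨rfl, rfl⟩ | ⟨rfl, rfl⟩
    · exact h2
    · have hcomm : ∀ y : V × Fin d → ℝ, sqDist u w y = sqDist w u y := fun y =>
        Finset.sum_congr rfl fun i _ => sub_sq_comm _ _
      exact (hcomm q).trans (h2.trans (hcomm x).symm)
  · have := h u w
    rw [EuclideanSpace.dist_eq_sqrt_sqDist, EuclideanSpace.dist_eq_sqrt_sqDist] at this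
    exact (Real.sqrt_inj (Finset.sum_nonneg fun i _ => sq_nonneg _)
      (Finset.sum_nonneg fun i _ => sq_nonneg _)).1 this
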